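/- arXiv:2401.00485 — 3 statements merged into one kernel-verified Lean document; each statement's English description precedes it below -/
import Mathlib

section
/- Let A and B be complex unital Banach algebras with A commutative and semisimple, and let T : A → B be a surjective map which is spectrally additive, i.e. σ(x + y) = σ(Tx + Ty) for all x, y ∈ A. Then T is an algebra isomorphism: T is bijective, complex-linear, unital, and multiplicative. -/
open NormedSpace

universe u v

/-- A separating seminorm on a complex vector space is the norm of a linearly isomorphic
normed space. -/
theorem Seminorm.exists_linearEquiv_normedSpace {E : Type u} [AddCommGroup E] [Module ℂ E]
    (p : Seminorm ℂ E) (hp : ∀ x, p x = 0 → x = 0) :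
    ∃ (F : Type u) (_ : NormedAddCommGroup F) (_ : NormedSpace ℂ F) (e : E ≃ₗ[ℂ] F),
      ∀ x, ‖e x‖ = p x := by
  let : Norm E := ⟨p⟩
  have core : NormedSpace.Core ℂ E :=
    { norm_nonneg := fun x => apply_nonneg p x
      norm_smul := fun c x => map_smul_eq_mul p c x
      norm_triangle := fun x y => map_add_le_add p x y
      norm_eq_zero_iff := fun x => ⟨hp x, by rintro rfl; exact map_zero p⟩ }
  let := NormedAddCommGroup.ofCore core
  exact ⟨E, inferInstance, NormedSpace.ofCore core, LinearEquiv.refl ℂ E, fun _ => rfl⟩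

theorem Multiset.two_mul_esymm_two {R : Type*} [CommRing R] (s : Multiset R) :
    2 * s.esymm 2 = s.esymm 1 ^ 2 - (s.map (· ^ 2)).sum := by
  induction s using Multiset.induction with
  | empty => simp [Multiset.esymm, Multiset.powersetCard_zero_right]
  | cons a s ih =>
    have h1 : (a ::ₘ s).esymm 1 = s.esymm 1 + a := by
      simp [Multiset.esymm, Multiset.powersetCard_one, add_comm]
    have h2 : (a ::ₘ s).esymm 2 = s.esymm 2 + a * s.esymm 1 := by
      simp [Multiset.esymm, Multiset.powersetCard_cons, Multiset.sum_map_mul_left]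
    rw [h1, h2, Multiset.map_cons, Multiset.sum_cons]
    linear_combination ih

section SpectralRadius

variable {A : Type*} [NormedRing A] [NormedAlgebra ℂ A]

theorem toReal_spectralRadius_le {x : A} {M : ℝ} (hM : 0 ≤ M)
    (h : ∀ z ∈ spectrum ℂ x, ‖z‖ ≤ M) : (spectralRadius ℂ x).toReal ≤ M := by
  refine ENNReal.toReal_le_of_le_ofReal hM (iSup₂_le fun z hz => ?_)
  rw [← ENNReal.ofReal_coe_nnreal]
  exact ENNReal.ofReal_le_ofReal (h z hz)

variable [CompleteSpace A]

theorem norm_le_toReal_spectralRadius {x : A} {z : ℂ} (hz : z ∈ spectrum ℂ x) :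
    ‖z‖ ≤ (spectralRadius ℂ x).toReal := by
  have : Nontrivial A := by
    by_contra h
    rw [not_nontrivial_iff_subsingleton] at h
    simp [spectrum.of_subsingleton] at hz
  have h : (‖z‖₊ : ENNReal) ≤ spectralRadius ℂ x := le_iSup₂ (α := ENNReal) z hz
  obtain ⟨w, -, hw⟩ := spectrum.exists_nnnorm_eq_spectralRadius x
  rw [← hw] at h ⊢
  exact_mod_cast h

theorem toReal_spectralRadius_le_norm_mul (x : A) :
    (spectralRadius ℂ x).toReal ≤ ‖x‖ * ‖(1 : A)‖ :=
  toReal_spectralRadius_le (by positivity) fun _ hz => spectrum.norm_le_norm_mul_of_mem hz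

theorem toReal_spectralRadius_smul_le (c : ℂ) (x : A) :
    (spectralRadius ℂ (c • x)).toReal ≤ ‖c‖ * (spectralRadius ℂ x).toReal := by
  refine toReal_spectralRadius_le (by positivity) fun z hz => ?_
  rcases eq_or_ne c 0 with rfl | hc
  · have : Nontrivial A := by
      by_contra h
      rw [not_nontrivial_iff_subsingleton] at h
      simp [spectrum.of_subsingleton] at hz
    simp at hz
    simp [hz]
  · have := spectrum.unit_smul_eq_smul x (Units.mk0 c hc)
    simp only [Units.smul_mk0] at this
    rw [this] at hz
    obtain ⟨w, hw, rfl⟩ := hz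
    simpa using mul_le_mul_of_nonneg_left (norm_le_toReal_spectralRadius hw) (norm_nonneg c)

theorem toReal_spectralRadius_smul (c : ℂ) (x : A) :
    (spectralRadius ℂ (c • x)).toReal = ‖c‖ * (spectralRadius ℂ x).toReal := by
  refine le_antisymm (toReal_spectralRadius_smul_le c x) ?_
  rcases eq_or_ne c 0 with rfl | hc
  · simp
  have h := toReal_spectralRadius_smul_le c⁻¹ (c • x)
  rw [inv_smul_smul₀ hc, norm_inv] at h
  have hc' : 0 < ‖c‖ := norm_pos_iff.2 hc
  rwa [← div_eq_inv_mul, le_div_iff₀ hc', mul_comm] at h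

theorem spectrum_subset_zero_of_toReal_spectralRadius_eq_zero {x : A}
    (h : (spectralRadius ℂ x).toReal = 0) : spectrum ℂ x ⊆ {0} := fun z hz => by
  have := norm_le_toReal_spectralRadius hz
  rw [h] at this
  simpa using this

/-- The spectral radius as a seminorm, when it is subadditive. -/
noncomputable def spectralSeminorm
    (hadd : ∀ x y : A, (spectralRadius ℂ (x + y)).toReal ≤
      (spectralRadius ℂ x).toReal + (spectralRadius ℂ y).toReal) : Seminorm ℂ A :=
  Seminorm.of (fun x => (spectralRadius ℂ x).toReal) hadd toReal_spectralRadius_smul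

/-- If the spectral radius is subadditive and there are no nonzero quasinilpotents, the algebra is commutative. -/
theorem mul_comm_of_spectralRadius_norm
    (hadd : ∀ x y : A, (spectralRadius ℂ (x + y)).toReal ≤
      (spectralRadius ℂ x).toReal + (spectralRadius ℂ y).toReal)
    (h0 : ∀ x : A, spectrum ℂ x ⊆ {0} → x = 0) (a b : A) : a * b = b * a := by
  obtain ⟨F, _, _, e, he⟩ := (spectralSeminorm hadd).exists_linearEquiv_normedSpace
    fun x hx => h0 x (spectrum_subset_zero_of_toReal_spectralRadius_eq_zero hx)
  replace he : ∀ x, ‖e x‖ = (spectralRadius ℂ x).toReal := he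
  let ι : A →L[ℂ] F := e.toLinearMap.mkContinuous ‖(1 : A)‖ fun x => by
    rw [mul_comm]
    exact (he x).trans_le (toReal_spectralRadius_le_norm_mul x)
  let _ : NormedAlgebra ℚ A := NormedAlgebra.restrictScalars ℚ ℂ A
  let f : ℂ → A := fun z => exp (z • a) * b * exp (z • (-a))
  have hf : Differentiable ℂ f :=
    ((differentiable_exp_smul_const ℂ a).mul_const b).mul (differentiable_exp_smul_const ℂ (-a))
  have hinv : ∀ z : ℂ, exp (z • (-a)) * exp (z • a) = 1 := fun z => by
    rw [← exp_add_of_commute, smul_neg, neg_add_cancel, exp_zero]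
    rw [smul_neg]; exact (Commute.refl _).neg_left
  have hinv' : ∀ z : ℂ, exp (z • a) * exp (z • (-a)) = 1 := fun z => by
    simpa using hinv (-z)
  have hspec : ∀ z, spectrum ℂ (f z) = spectrum ℂ b := fun z =>
    spectrum.units_conjugate (u := ⟨exp (z • a), exp (z • (-a)), hinv' z, hinv z⟩)
  have hconst : ∀ z, f z = b := fun z => by
    have h : (ι ∘ f) z = (ι ∘ f) 0 := by
      refine Differentiable.apply_eq_apply_of_bounded (ι.differentiable.comp hf) ?_ z 0
      refine isBounded_iff_forall_norm_le.2 ⟨(spectralRadius ℂ b).toReal, ?_⟩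
      rintro _ ⟨w, rfl⟩
      refine (he (f w)).trans_le (le_of_eq ?_)
      simp only [spectralRadius, hspec]
    have h' : f z = f 0 := e.injective h
    simpa [f] using h'
  have hcomm : (fun z : ℂ => exp (z • a) * b) = fun z => b * exp (z • a) := by
    funext z
    calc exp (z • a) * b = f z * exp (z • a) := by simp only [f, mul_assoc, hinv, mul_one]
      _ = _ := by rw [hconst]
  have h1 := (hasDerivAt_exp_smul_const a (0 : ℂ)).mul_const b
  have h2 := (hasDerivAt_exp_smul_const a (0 : ℂ)).const_mul b
  rw [hcomm] at h1
  simpa using h1.unique h2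

end SpectralRadius

section Functionals

variable {A : Type*} [NormedRing A] [NormedAlgebra ℂ A]

theorem nontrivial_of_forall_mem_spectrum {ψ : A → ℂ} (h : ∀ x, ψ x ∈ spectrum ℂ x) :
    Nontrivial A := by
  by_contra hA
  rw [not_nontrivial_iff_subsingleton] at hA
  simpa [spectrum.of_subsingleton] using h 0

theorem apply_one_of_forall_mem_spectrum {ψ : A → ℂ} (h : ∀ x, ψ x ∈ spectrum ℂ x) :
    ψ 1 = 1 := by
  have := nontrivial_of_forall_mem_spectrum h
  simpa using h 1

variable [CompleteSpace A]

/-- A real-linear functional with values in the spectrum is complex-linear. -/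
theorem map_I_smul_of_forall_mem_spectrum (ψ : A →ₗ[ℝ] ℂ) (h : ∀ x, ψ x ∈ spectrum ℂ x)
    (x : A) : ψ (Complex.I • x) = Complex.I * ψ x := by
  have hA := nontrivial_of_forall_mem_spectrum h
  have hscalar : ∀ c : ℂ, ψ (c • 1) = c := fun c => by
    simpa [← Algebra.algebraMap_eq_smul_one] using h (c • 1)
  have hreal : ∀ (r : ℝ) y, ψ ((r : ℂ) • y) = r * ψ y := fun r y => by
    simp
  have hcplx : ∀ (c : ℂ) y, ψ (c • y) = c.re * ψ y + c.im * ψ (Complex.I • y) := fun c y => by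
    conv_lhs => rw [← Complex.re_add_im c]
    rw [add_smul, map_add, mul_smul, hreal, hreal]
  have hII : ∀ y : A, ψ (Complex.I • Complex.I • y) = -ψ y := fun y => by
    rw [smul_smul, Complex.I_mul_I, neg_one_smul, map_neg]
  have hbound : ∀ y, ‖ψ y‖ ≤ ‖(1 : A)‖ * ‖y‖ := fun y => by
    rw [mul_comm]; exact spectrum.norm_le_norm_mul_of_mem (h y)
  have hboundI : ∀ y, ‖Complex.I * ψ (Complex.I • y)‖ ≤ ‖(1 : A)‖ * ‖y‖ := fun y => by
    simpa [norm_smul] using hbound (Complex.I • y)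
  -- `ψ = P + conj ∘ Q` with `P` and `Q` complex-linear
  let P : A →L[ℂ] ℂ := LinearMap.mkContinuous
    { toFun := fun y => (ψ y - Complex.I * ψ (Complex.I • y)) / 2
      map_add' := fun y z => by simp only [smul_add, map_add]; ring
      map_smul' := fun c y => by
        rw [smul_comm Complex.I c, hcplx c, hcplx c, hII, RingHom.id_apply, smul_eq_mul]
        conv_rhs => rw [← Complex.re_add_im c]
        linear_combination ((c.im : ℂ) * ψ (Complex.I • y) / 2) * Complex.I_sq } ‖(1 : A)‖
    fun y => by
      change ‖(ψ y - Complex.I * ψ (Complex.I • y)) / 2‖ ≤ _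
      rw [norm_div, Complex.norm_ofNat, div_le_iff₀ two_pos]
      linarith [norm_sub_le (ψ y) (Complex.I * ψ (Complex.I • y)), hbound y, hboundI y]
  let Q : A →L[ℂ] ℂ := LinearMap.mkContinuous
    { toFun := fun y => star ((ψ y + Complex.I * ψ (Complex.I • y)) / 2)
      map_add' := fun y z => by
        rw [← star_add]; congr 1; simp only [smul_add, map_add]; ring
      map_smul' := fun c y => by
        have hc : c = star ((c.re : ℂ) - c.im * Complex.I) := by
          apply Complex.ext <;> simp
        rw [RingHom.id_apply, smul_eq_mul]
        conv_rhs => rw [hc, ← star_mul']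
        congr 1
        rw [smul_comm Complex.I c, hcplx c, hcplx c, hII]
        linear_combination ((c.im : ℂ) * ψ (Complex.I • y) / 2) * Complex.I_sq } ‖(1 : A)‖
    fun y => by
      change ‖star ((ψ y + Complex.I * ψ (Complex.I • y)) / 2)‖ ≤ _
      rw [norm_star, norm_div, Complex.norm_ofNat, div_le_iff₀ two_pos]
      linarith [norm_add_le (ψ y) (Complex.I * ψ (Complex.I • y)), hbound y, hboundI y]
  have hP : ∀ y, P y = (ψ y - Complex.I * ψ (Complex.I • y)) / 2 := fun _ => rfl
  have hQ : ∀ y, Q y = star ((ψ y + Complex.I * ψ (Complex.I • y)) / 2) := fun _ => rfl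
  have hPQ : ∀ y, ψ y = P y + star (Q y) := fun y => by
    rw [hP, hQ, star_star]; ring
  have hP1 : P 1 = 1 := by
    rw [hP, hscalar, ← one_smul ℂ (1 : A), hscalar]
    linear_combination (-1 / 2 : ℂ) * Complex.I_sq
  have hQ1 : Q 1 = 0 := by
    rw [hQ, hscalar, ← one_smul ℂ (1 : A), hscalar, Complex.I_mul_I]
    simp
  have hunit : ∀ u : A, IsUnit u → ‖P u‖ ≠ ‖Q u‖ := fun u hu heq => by
    obtain ⟨c, hc0, hc⟩ : ∃ c : ℂ, c ≠ 0 ∧ c * P u + star (c * Q u) = 0 := by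
      rcases eq_or_ne (P u) 0 with h0 | h0
      · have : Q u = 0 := by simpa [h0] using heq.symm
        exact ⟨1, one_ne_zero, by simp [h0, this]⟩
      · obtain ⟨c, hc⟩ := IsAlgClosed.exists_pow_nat_eq (-star (Q u) / P u) (n := 2) two_pos
        have hn : ‖c‖ = 1 := by
          have : ‖c‖ ^ 2 = 1 := by
            rw [← norm_pow, hc, norm_div, norm_neg, norm_star, ← heq,
              div_self (norm_ne_zero_iff.2 h0)]
          exact (pow_eq_one_iff_of_nonneg (norm_nonneg c) two_ne_zero).1 this
        have hcc : c * star c = 1 := by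
          have := Complex.mul_conj' c
          rw [hn] at this
          simpa using this
        refine ⟨c, norm_ne_zero_iff.1 (by simp [hn]), ?_⟩
        rw [eq_div_iff h0] at hc
        rw [star_mul']
        linear_combination star c * hc + (-c * P u) * hcc
    have h0 : ψ (c • u) = 0 := by
      rw [hPQ, map_smul, map_smul]; exact hc
    have hmem := h (c • u)
    rw [h0] at hmem
    exact spectrum.zero_mem_iff ℂ |>.1 hmem (hu.smul (Units.mk0 c hc0))
  let _ : NormedAlgebra ℚ A := NormedAlgebra.restrictScalars ℚ ℂ A
  have hexp : Differentiable ℂ fun z : ℂ => exp (z • x) := differentiable_exp_smul_const ℂ x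
  have hlt : ∀ z : ℂ, ‖Q (exp (z • x))‖ < ‖P (exp (z • x))‖ := fun z => by
    have hcont : Continuous fun z : ℂ => ‖P (exp (z • x))‖ - ‖Q (exp (z • x))‖ :=
      (P.continuous.comp hexp.continuous).norm.sub (Q.continuous.comp hexp.continuous).norm
    by_contra hz
    obtain ⟨w, hw⟩ := mem_range_of_exists_le_of_exists_ge hcont
      ⟨z, sub_nonpos.2 (not_lt.1 hz)⟩ ⟨0, by simp [hP1, hQ1]⟩
    exact hunit _ (isUnit_exp _) (sub_eq_zero.1 hw)
  have hPne : ∀ z : ℂ, P (exp (z • x)) ≠ 0 := fun z =>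
    norm_pos_iff.1 ((norm_nonneg _).trans_lt (hlt z))
  have hQzero : (fun z : ℂ => Q (exp (z • x))) = fun _ => 0 := by
    funext z
    have hdiff : Differentiable ℂ fun z : ℂ => Q (exp (z • x)) / P (exp (z • x)) :=
      (Q.differentiable.comp hexp).div (P.differentiable.comp hexp) hPne
    have := hdiff.apply_eq_apply_of_bounded (isBounded_iff_forall_norm_le.2 ⟨1, by
      rintro _ ⟨w, rfl⟩
      rw [norm_div]
      exact div_le_one_of_le₀ (hlt w).le (norm_nonneg _)⟩) z 0
    simpa [hQ1, hPne] using this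
  have hQx : Q x = 0 := by
    have hd := Q.hasFDerivAt.comp_hasDerivAt (0 : ℂ) (hasDerivAt_exp_smul_const x (0 : ℂ))
    change HasDerivAt (fun z : ℂ => Q (exp (z • x))) _ 0 at hd
    rw [hQzero] at hd
    simpa using hd.unique (hasDerivAt_const (0 : ℂ) (0 : ℂ))
  rw [hQ, star_eq_zero, div_eq_zero_iff] at hQx
  have h2 := hQx.resolve_right two_ne_zero
  linear_combination (-Complex.I) * h2 + ψ (Complex.I • x) * Complex.I_sq

/-- The Gleason–Kahane–Żelazko theorem, for squares. -/
theorem map_sq_of_forall_mem_spectrum (ψ : A →ₗ[ℂ] ℂ) (h : ∀ x, ψ x ∈ spectrum ℂ x)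
    (x : A) : ψ (x ^ 2) = ψ x ^ 2 := by
  have h1 := apply_one_of_forall_mem_spectrum h
  set R := ‖x‖ * ‖(1 : A)‖
  have key : ∀ n : ℕ, ‖((n : ℂ) + 2) ^ 2 * ψ x ^ 2 - (n + 2) * (n + 1) * ψ (x ^ 2)‖
      ≤ (n + 2) * R ^ 2 := fun n => by
    let p : Polynomial ℂ := ∑ m ∈ Finset.range (n + 2 + 1),
      Polynomial.monomial m (ψ ((-x) ^ (n + 2 - m)) * ((n + 2).choose m : ℂ))
    have hcoeff : ∀ m, m ≤ n + 2 →
        p.coeff m = ψ ((-x) ^ (n + 2 - m)) * ((n + 2).choose m : ℂ) := fun m hm => by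
      simp only [p, Polynomial.finsetSum_coeff, Polynomial.coeff_monomial]
      rw [Finset.sum_ite_eq' , if_pos (Finset.mem_range.2 (by lia))]
    have hlead : p.coeff (n + 2) = 1 := by rw [hcoeff _ le_rfl]; simp [h1]
    have hdeg : p.natDegree = n + 2 := by
      refine Polynomial.natDegree_eq_of_le_of_coeff_ne_zero ?_ (by simp [hlead])
      refine Polynomial.natDegree_sum_le_of_forall_le _ _ fun m hm => ?_
      exact (Polynomial.natDegree_monomial_le _).trans (by simp at hm; lia)
    have hmonic : p.leadingCoeff = 1 := by rw [Polynomial.leadingCoeff, hdeg, hlead]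
    have hcard := Polynomial.splits_iff_card_roots.1 (IsAlgClosed.splits p)
    have hvieta := fun {k} => Polynomial.coeff_eq_esymm_roots_of_card hcard (k := k)
    rw [hdeg, hmonic] at hvieta
    have he1 : p.roots.esymm 1 = (n + 2) * ψ x := by
      have := hvieta (k := n + 1) (by lia)
      rw [hcoeff _ (by lia), show n + 2 - (n + 1) = 1 by lia, Nat.choose_succ_self_right] at this
      simp at this
      linear_combination -this
    have he2 : 2 * p.roots.esymm 2 = (n + 2) * (n + 1) * ψ (x ^ 2) := by
      have := hvieta (k := n) (by lia)
      rw [hcoeff _ (by lia), show n + 2 - n = 2 by lia,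
        ← Nat.choose_symm_of_eq_add (show n + 2 = 2 + n by lia), Nat.cast_choose_two] at this
      push_cast at this
      simp at this
      linear_combination -2 * this
    have hsq := p.roots.two_mul_esymm_two
    have hroot : ∀ z ∈ p.roots, ‖z‖ ≤ R := fun z hz => by
      have hz0 : ψ ((algebraMap ℂ A z + -x) ^ (n + 2)) = 0 := by
        rw [Commute.add_pow (Algebra.commutes z (-x)), map_sum,
          ← (Polynomial.mem_roots'.1 hz).2]
        simp only [p, Polynomial.eval_finsetSum, Polynomial.eval_monomial]
        refine Finset.sum_congr rfl fun m _ => ?_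
        rw [← map_pow, ← Nat.cast_comm, ← nsmul_eq_mul, map_nsmul, ← Algebra.smul_def, map_smul,
          nsmul_eq_mul, smul_eq_mul]
        ring
      have hmem := h ((algebraMap ℂ A z + -x) ^ (n + 2))
      rw [hz0, spectrum.zero_mem_iff, isUnit_pow_iff (by lia), ← sub_eq_add_neg] at hmem
      exact spectrum.norm_le_norm_mul_of_mem hmem
    have hsum : ‖(p.roots.map (· ^ 2)).sum‖ ≤ (n + 2) * R ^ 2 := by
      refine (norm_multiset_sum_le _).trans ?_
      rw [Multiset.map_map]
      refine (Multiset.sum_le_card_nsmul _ (R ^ 2) fun y hy => ?_).trans ?_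
      · obtain ⟨z, hz, rfl⟩ := Multiset.mem_map.1 hy
        simpa using pow_le_pow_left₀ (norm_nonneg z) (hroot z hz) 2
      · simp [hcard, hdeg]
    convert hsum using 2
    rw [he2, he1] at hsq
    linear_combination -hsq
  by_contra hne
  have hpos : 0 < ‖ψ x ^ 2 - ψ (x ^ 2)‖ := norm_pos_iff.2 (sub_ne_zero.2 (Ne.symm hne))
  obtain ⟨n, hn⟩ := exists_nat_gt ((R ^ 2 + ‖ψ (x ^ 2)‖) / ‖ψ x ^ 2 - ψ (x ^ 2)‖)
  rw [div_lt_iff₀ hpos] at hn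
  have hle : ((n : ℝ) + 2) * ((n + 2) * ‖ψ x ^ 2 - ψ (x ^ 2)‖) ≤
      (n + 2) * (R ^ 2 + ‖ψ (x ^ 2)‖) := by
    have hnorm : ‖(n : ℂ) + 2‖ = n + 2 := by
      exact_mod_cast Complex.norm_natCast (n + 2)
    have heq : ((n : ℂ) + 2) * ((n + 2) * (ψ x ^ 2 - ψ (x ^ 2))) =
        ((n + 2) ^ 2 * ψ x ^ 2 - (n + 2) * (n + 1) * ψ (x ^ 2)) - (n + 2) * ψ (x ^ 2) := by ring
    have := norm_sub_le (((n : ℂ) + 2) ^ 2 * ψ x ^ 2 - (n + 2) * (n + 1) * ψ (x ^ 2))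
      ((n + 2) * ψ (x ^ 2))
    rw [← heq, norm_mul, norm_mul, norm_mul, hnorm] at this
    linarith [key n]
  have := le_of_mul_le_mul_left hle (by positivity)
  nlinarith

end Functionals

section Commutative

variable {A : Type u} [NormedCommRing A] [NormedAlgebra ℂ A] [CompleteSpace A]

theorem map_mul_of_forall_mem_spectrum (ψ : A →ₗ[ℂ] ℂ) (h : ∀ x, ψ x ∈ spectrum ℂ x)
    (x y : A) : ψ (x * y) = ψ x * ψ y := by
  have hxy := map_sq_of_forall_mem_spectrum ψ h (x + y)
  have : (x + y) ^ 2 = x ^ 2 + (2 : ℂ) • (x * y) + y ^ 2 := by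
    rw [two_smul]; ring
  rw [this, map_add, map_add, map_add, map_smul, map_sq_of_forall_mem_spectrum ψ h,
    map_sq_of_forall_mem_spectrum ψ h, smul_eq_mul] at hxy
  linear_combination hxy / 2

theorem toReal_spectralRadius_add_le (x y : A) : (spectralRadius ℂ (x + y)).toReal ≤
    (spectralRadius ℂ x).toReal + (spectralRadius ℂ y).toReal := by
  refine toReal_spectralRadius_le (by positivity) fun z hz => ?_
  obtain ⟨f, rfl⟩ := WeakDual.CharacterSpace.mem_spectrum_iff_exists.1 hz
  rw [map_add]
  exact (norm_add_le _ _).trans (add_le_add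
    (norm_le_toReal_spectralRadius (AlgHom.apply_mem_spectrum f x))
    (norm_le_toReal_spectralRadius (AlgHom.apply_mem_spectrum f y)))

theorem eq_zero_of_spectrum_subset_zero (hA : Ideal.jacobson (⊥ : Ideal A) = ⊥) {x : A}
    (hx : spectrum ℂ x ⊆ {0}) : x = 0 := by
  rw [← Ideal.mem_bot, ← hA, Ideal.mem_jacobson_bot]
  intro y
  by_contra hu
  obtain ⟨f, hf⟩ := WeakDual.CharacterSpace.exists_apply_eq_zero hu
  have hfx : f x = 0 := hx (AlgHom.apply_mem_spectrum f x)
  simp [hfx] at hf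

/-- A real-linear spectrum-preserving map into a commutative Banach algebra without nonzero
quasinilpotents is complex-linear and multiplicative. -/
theorem complexLinear_and_multiplicative_of_spectrum_eq
    {B : Type v} [NormedCommRing B] [NormedAlgebra ℂ B] [CompleteSpace B]
    (h0 : ∀ b : B, spectrum ℂ b ⊆ {0} → b = 0) (T : A →ₗ[ℝ] B)
    (hT : ∀ x, spectrum ℂ (T x) = spectrum ℂ x) :
    (∀ (c : ℂ) (x : A), T (c • x) = c • T x) ∧ ∀ x y : A, T (x * y) = T x * T y := by
  have hext : ∀ a b : B, (∀ f : WeakDual.characterSpace ℂ B, f a = f b) → a = b := by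
    intro a b hab
    refine sub_eq_zero.1 (h0 _ fun z hz => ?_)
    obtain ⟨f, rfl⟩ := WeakDual.CharacterSpace.mem_spectrum_iff_exists.1 hz
    simp [hab f]
  have hreal : ∀ (r : ℝ) (x : A), T ((r : ℂ) • x) = (r : ℂ) • T x := fun r x => by
    simp
  have hmem : ∀ (f : WeakDual.characterSpace ℂ B) x, f (T x) ∈ spectrum ℂ x := fun f x => by
    rw [← hT]; exact AlgHom.apply_mem_spectrum f (T x)
  have hI : ∀ x, T (Complex.I • x) = Complex.I • T x := fun x => hext _ _ fun f => by
    let ψ : A →ₗ[ℝ] ℂ :=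
      { toFun := fun x => f (T x)
        map_add' := fun x y => by simp
        map_smul' := fun r x => by
          rw [T.map_smul, ← Complex.coe_smul, map_smul]; simp }
    rw [map_smul f]
    exact map_I_smul_of_forall_mem_spectrum ψ (hmem f) x
  have hsmul : ∀ (c : ℂ) (x : A), T (c • x) = c • T x := fun c x => by
    conv_lhs => rw [← Complex.re_add_im c]
    conv_rhs => rw [← Complex.re_add_im c]
    rw [add_smul, add_smul, map_add, mul_smul, mul_smul, hreal, hreal, hI]
  refine ⟨hsmul, fun x y => hext _ _ fun f => ?_⟩
  let ψ : A →ₗ[ℂ] ℂ :=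
    { toFun := fun x => f (T x)
      map_add' := fun x y => by simp
      map_smul' := fun c x => by rw [hsmul, map_smul]; rfl }
  rw [map_mul f]
  exact map_mul_of_forall_mem_spectrum ψ (hmem f) x y

theorem complexLinear_and_multiplicative_of_spectrum_eq_of_mul_comm
    {B : Type v} [NormedRing B] [NormedAlgebra ℂ B] [CompleteSpace B]
    (hcomm : ∀ a b : B, a * b = b * a) (h0 : ∀ b : B, spectrum ℂ b ⊆ {0} → b = 0)
    (T : A →ₗ[ℝ] B) (hT : ∀ x, spectrum ℂ (T x) = spectrum ℂ x) :
    (∀ (c : ℂ) (x : A), T (c • x) = c • T x) ∧ ∀ x y : A, T (x * y) = T x * T y :=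
  let _ : NormedCommRing B := { ‹NormedRing B› with mul_comm := hcomm }
  complexLinear_and_multiplicative_of_spectrum_eq h0 T hT

end Commutative

/-- The Mazur–Ulam theorem for spaces normed by separating seminorms. -/
theorem Seminorm.exists_realLinearMap_of_map_sub {E : Type u} {F : Type v} [AddCommGroup E]
    [Module ℂ E] [AddCommGroup F] [Module ℂ F] (p : Seminorm ℂ E) (q : Seminorm ℂ F)
    (hp : ∀ x, p x = 0 → x = 0) (hq : ∀ x, q x = 0 → x = 0) (T : E → F)
    (hT : Function.Surjective T) (hT0 : T 0 = 0) (h : ∀ x y, q (T x - T y) = p (x - y)) :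
    ∃ L : E →ₗ[ℝ] F, ∀ x, L x = T x := by
  obtain ⟨E', _, _, e, he⟩ := p.exists_linearEquiv_normedSpace hp
  obtain ⟨F', _, _, f, hf⟩ := q.exists_linearEquiv_normedSpace hq
  have hiso : Isometry fun x => f (T (e.symm x)) := Isometry.of_dist_eq fun x y => by
    rw [dist_eq_norm, dist_eq_norm, ← map_sub, hf, h, ← map_sub, ← he, e.apply_symm_apply]
  have hsurj : Function.Surjective fun x => f (T (e.symm x)) :=
    f.surjective.comp (hT.comp e.symm.surjective)
  let S : E' ≃ᵢ F' := IsometryEquiv.mk' (fun x => f (T (e.symm x)))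
    (Function.surjInv hsurj) (Function.surjInv_eq hsurj) hiso
  let L := S.toRealLinearIsometryEquivOfMapZero (by simp [S, IsometryEquiv.mk', hT0])
  refine ⟨(f.symm.toLinearMap.restrictScalars ℝ) ∘ₗ L.toLinearEquiv.toLinearMap ∘ₗ
    (e.toLinearMap.restrictScalars ℝ), fun x => ?_⟩
  change f.symm (f (T (e.symm (e x)))) = T x
  simp

/-- A surjective spectrally additive map from a commutative semisimple complex unital
Banach algebra onto a complex unital Banach algebra is an algebra isomorphism. -/
theorem spectrally_additive_from_commutative_is_algebra_iso
    {A B : Type*} [NormedCommRing A] [NormedAlgebra ℂ A] [CompleteSpace A]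
    [NormedRing B] [NormedAlgebra ℂ B] [CompleteSpace B]
    (hA : Ideal.jacobson (⊥ : Ideal A) = ⊥)
    (T : A → B)
    (hsurj : Function.Surjective T)
    (hsa : ∀ x y : A, spectrum ℂ (x + y) = spectrum ℂ (T x + T y)) :
    Function.Bijective T ∧
      (∀ (c : ℂ) (x : A), T (c • x) = c • T x) ∧
      (∀ x y : A, T (x + y) = T x + T y) ∧
      T 1 = 1 ∧
      ∀ x y : A, T (x * y) = T x * T y := by
  have hA0 : ∀ x : A, spectrum ℂ x ⊆ {0} → x = 0 := fun x =>
    eq_zero_of_spectrum_subset_zero hA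
  have hzero : spectrum ℂ (0 : B) ⊆ {0} := fun z hz => by
    rw [Set.mem_singleton_iff]
    simpa using spectrum.norm_le_norm_mul_of_mem hz
  have hneg : ∀ x, T (-x) = -T x := fun x => by
    obtain ⟨z, hz⟩ := hsurj (-T x)
    have : x + z = 0 := hA0 _ (by rwa [hsa, hz, add_neg_cancel])
    rw [← hz, eq_neg_of_add_eq_zero_right this]
  have hsub : ∀ x y, spectrum ℂ (T x - T y) = spectrum ℂ (x - y) := fun x y => by
    rw [sub_eq_add_neg, sub_eq_add_neg, hsa, hneg]
  have hinj : Function.Injective T := fun x y hxy => by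
    refine sub_eq_zero.1 (hA0 _ ?_)
    rwa [← hsub, hxy, sub_self]
  have hT0 : T 0 = 0 := by
    have h := hneg 0
    rw [neg_zero] at h
    rw [eq_neg_iff_add_eq_zero, ← two_smul ℂ] at h
    exact (smul_eq_zero_iff_right two_ne_zero).1 h
  have hspec : ∀ x, spectrum ℂ (T x) = spectrum ℂ x := fun x => by
    simpa [hT0] using hsub x 0
  have hB0 : ∀ b : B, spectrum ℂ b ⊆ {0} → b = 0 := fun b hb => by
    obtain ⟨x, rfl⟩ := hsurj b
    rw [hA0 x (by rwa [← hspec]), hT0]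
  have hadd : ∀ a b : B, (spectralRadius ℂ (a + b)).toReal ≤
      (spectralRadius ℂ a).toReal + (spectralRadius ℂ b).toReal := fun a b => by
    obtain ⟨x, rfl⟩ := hsurj a
    obtain ⟨y, rfl⟩ := hsurj b
    simpa only [spectralRadius, hspec, ← hsa] using toReal_spectralRadius_add_le x y
  obtain ⟨L, hL⟩ := Seminorm.exists_realLinearMap_of_map_sub
    (spectralSeminorm (A := A) toReal_spectralRadius_add_le) (spectralSeminorm hadd)
    (fun x hx => hA0 x (spectrum_subset_zero_of_toReal_spectralRadius_eq_zero hx))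
    (fun x hx => hB0 x (spectrum_subset_zero_of_toReal_spectralRadius_eq_zero hx))
    T hsurj hT0 fun x y => by
      change (spectralRadius ℂ (T x - T y)).toReal = (spectralRadius ℂ (x - y)).toReal
      simp only [spectralRadius, hsub]
  have hlin := complexLinear_and_multiplicative_of_spectrum_eq_of_mul_comm
    (mul_comm_of_spectralRadius_norm hadd hB0) hB0 L fun x => by rw [hL]; exact hspec x
  simp only [hL] at hlin
  refine ⟨⟨hinj, hsurj⟩, hlin.1, fun x y => by rw [← hL, ← hL, ← hL, map_add], ?_, hlin.2⟩
  obtain ⟨e, he⟩ := hsurj 1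
  calc T 1 = T 1 * T e := by rw [he, mul_one]
    _ = 1 := by rw [← hlin.2, one_mul, he]
end

section
/- Let A and B be complex unital Banach algebras with A semisimple, and let T : A → B be a surjective map with T(λ·1 + x) = λ·1 + Tx for every λ ∈ ℂ and x ∈ A, and such that r(x + y) = r(Tx + Ty) for all x, y ∈ A. Then T maps the centre Z(A) bijectively onto the centre Z(B), and the restriction of T to Z(A) is an algebra isomorphism onto Z(B) (complex-linear, multiplicative, unital, bijective). In particular this conclusion holds whenever T : A → B is a surjective spectrally additive map. -/
/-- Schur's lemma (Gelfand–Mazur form). -/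
theorem exists_smul_of_quotient_end {A : Type*} [NormedRing A] [NormedAlgebra ℂ A]
    [CompleteSpace A] (M : Ideal A) [hM : M.IsMaximal] (f : (A ⧸ M) →ₗ[A] (A ⧸ M)) :
    ∃ c : ℂ, ∀ v, f v = c • v := by
  have hcl : IsClosed (M : Set A) := Ideal.IsMaximal.isClosed
  have : IsSimpleModule A (A ⧸ M) := isSimpleModule_iff_isCoatom.2 hM.out
  have : Nontrivial (A ⧸ M) := IsSimpleModule.nontrivial A _
  have hcont : ∀ g : (A ⧸ M) →ₗ[A] (A ⧸ M), Continuous g := by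
    intro g
    obtain ⟨d, hd⟩ := Submodule.Quotient.mk_surjective M (g (Submodule.Quotient.mk 1))
    have hg : ∀ x : A, g (Submodule.Quotient.mk x) = Submodule.Quotient.mk (x * d) := by
      intro x
      have := g.map_smul x (Submodule.Quotient.mk 1)
      rw [← Submodule.Quotient.mk_smul, smul_eq_mul, mul_one, ← hd] at this
      rw [this, ← Submodule.Quotient.mk_smul, smul_eq_mul]
    refine AddMonoidHomClass.continuous_of_bound g ‖d‖ fun v ↦ ?_
    refine le_of_forall_pos_le_add fun ε hε ↦ ?_
    obtain ⟨x, rfl, hx⟩ := Submodule.Quotient.norm_mk_lt v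
      (show 0 < ε / (‖d‖ + 1) by positivity)
    rw [hg]
    refine (Submodule.Quotient.norm_mk_le M _).trans ((norm_mul_le _ _).trans ?_)
    have h1 : ε / (‖d‖ + 1) * (‖d‖ + 1) = ε := by field_simp
    have h2 : 0 < ε / (‖d‖ + 1) := by positivity
    nlinarith [norm_nonneg d, norm_nonneg x]
  let F : (A ⧸ M) →L[ℂ] (A ⧸ M) := ⟨f.restrictScalars ℂ, hcont f⟩
  obtain ⟨c, hc⟩ := spectrum.nonempty F
  refine ⟨c, ?_⟩
  let cid : (A ⧸ M) →ₗ[A] (A ⧸ M) := 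
    { toFun := fun v ↦ c • v
      map_add' := fun v w ↦ smul_add _ _ _
      map_smul' := fun a v ↦ smul_comm _ _ _ }
  rcases LinearMap.bijective_or_eq_zero (cid - f) with h | h
  · refine absurd ?_ hc
    have : algebraMap ℂ ((A ⧸ M) →L[ℂ] (A ⧸ M)) c - F = 
       (ContinuousLinearEquiv.ofBijective (algebraMap ℂ ((A ⧸ M) →L[ℂ] (A ⧸ M)) c - F) 
         (LinearMap.ker_eq_bot.2 h.1) (LinearMap.range_eq_top.2 h.2) : (A ⧸ M) →L[ℂ] (A ⧸ M)) := by
      ext; simp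
    rw [spectrum.mem_resolventSet_iff, this]
    exact ⟨ContinuousLinearEquiv.toUnit _, rfl⟩
  · intro v
    have := LinearMap.congr_fun h v
    simp [cid, sub_eq_zero] at this
    exact this.symm

theorem exists_smul_eq_zero_smul_eq {A : Type*} [NormedRing A] [NormedAlgebra ℂ A]
    [CompleteSpace A] (M : Ideal A) [hM : M.IsMaximal] {v w : A ⧸ M} (hv : v ≠ 0)
    (hw : ∀ c : ℂ, w ≠ c • v) : ∃ b : A, b • v = 0 ∧ b • w = v := by
  have : IsSimpleModule A (A ⧸ M) := isSimpleModule_iff_isCoatom.2 hM.out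
  let p := LinearMap.toSpanSingleton A (A ⧸ M) v
  let q := LinearMap.toSpanSingleton A (A ⧸ M) w
  have hp : Function.Surjective p := IsSimpleModule.toSpanSingleton_surjective A hv
  rcases eq_or_ne ((LinearMap.ker p).map q) ⊥ with h | h
  · have hk : LinearMap.ker p ≤ LinearMap.ker q := by
      rwa [← LinearMap.le_ker_iff_map] at h
    let f := (LinearMap.ker p).liftQ q hk ∘ₗ (p.quotKerEquivOfSurjective hp).symm.toLinearMap
    obtain ⟨c, hc⟩ := exists_smul_of_quotient_end M f
    refine absurd ?_ (hw c)
    rw [← hc v]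
    have hs : (p.quotKerEquivOfSurjective hp).symm v = Submodule.Quotient.mk 1 := by
      rw [LinearEquiv.symm_apply_eq]
      simp [p]
    simp [f, hs, q]
  · have h := (eq_bot_or_eq_top ((LinearMap.ker p).map q)).resolve_left h
    have hv' : v ∈ (LinearMap.ker p).map q := h ▸ Submodule.mem_top
    obtain ⟨b, hb, hbv⟩ := hv'
    exact ⟨b, by simpa [p] using hb, by simpa [q] using hbv⟩

theorem nnnorm_le_spectralRadius_of_smul_eq {A : Type*} [NormedRing A] [NormedAlgebra ℂ A]
    (M : Ideal A) {v : A ⧸ M} (hv : v ≠ 0) {x : A} {c : ℂ} (h : x • v = c • v) :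
    (‖c‖₊ : ENNReal) ≤ spectralRadius ℂ x := by
  refine le_iSup₂ (f := fun (k : ℂ) (_ : k ∈ spectrum ℂ x) ↦ (‖k‖₊ : ENNReal)) c fun hu ↦ hv ?_
  obtain ⟨u, hu⟩ := hu
  have h0 : (u : A) • v = 0 := by
    rw [hu, sub_smul, h, algebraMap_smul, sub_self]
  simpa using congrArg (fun w ↦ (↑u⁻¹ : A) • w) h0 

theorem spectralRadius_ne_top {A : Type*} [NormedRing A] [NormedAlgebra ℂ A] [CompleteSpace A]
    (a : A) : spectralRadius ℂ a ≠ ⊤ := by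
  refine ne_top_of_le_ne_top ?_ (spectrum.spectralRadius_le_pow_nnnorm_pow_one_div ℂ a 0)
  simpa using ENNReal.mul_ne_top ENNReal.coe_ne_top ENNReal.coe_ne_top

theorem spectralRadius_neg {A : Type*} [NormedRing A] [NormedAlgebra ℂ A] (a : A) :
    spectralRadius ℂ (-a) = spectralRadius ℂ a := by
  have key : ∀ b : A, spectralRadius ℂ (-b) ≤ spectralRadius ℂ b := by
    intro b
    refine iSup₂_le fun k hk ↦ ?_
    rw [← spectrum.neg_eq, Set.mem_neg] at hk
    have := le_iSup₂ (f := fun (k : ℂ) (_ : k ∈ spectrum ℂ b) ↦ (‖k‖₊ : ENNReal)) _ hk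
    rwa [nnnorm_neg] at this
  exact le_antisymm (key a) (by simpa using key (-a))

theorem exists_smul_eq_of_spectralRadius_add_le {A : Type*} [NormedRing A] [NormedAlgebra ℂ A]
    [CompleteSpace A] {a : A}
    (h : ∀ x, spectralRadius ℂ (a + x) ≤ spectralRadius ℂ a + spectralRadius ℂ x)
    (M : Ideal A) [hM : M.IsMaximal] (v : A ⧸ M) : ∃ c : ℂ, a • v = c • v := by
  rcases eq_or_ne v 0 with rfl | hv
  · exact ⟨0, by simp⟩
  by_contra! hw
  obtain ⟨b, hbv, hbw⟩ := exists_smul_eq_zero_smul_eq M hv hw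
  obtain ⟨s, hs0, hs⟩ : ∃ s : ℂ, s ≠ 0 ∧ IsUnit (1 + s • b) := by
    refine ⟨((‖b‖ + 1 : ℝ) : ℂ)⁻¹ / 2, ?_, ?_⟩
    · have : (‖b‖ + 1 : ℝ) ≠ 0 := by positivity
      have := Complex.ofReal_ne_zero.2 this
      exact div_ne_zero (inv_ne_zero this) two_ne_zero
    · have := isUnit_one_sub_of_norm_lt_one (x := -((((‖b‖ + 1 : ℝ) : ℂ)⁻¹ / 2) • b)) ?_
      · simpa using this
      · rw [norm_neg, norm_smul, norm_div, norm_inv, Complex.norm_real,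
          Real.norm_of_nonneg (by positivity)]
        have := norm_nonneg b
        simp only [Complex.norm_ofNat]
        field_simp
        linarith
  obtain ⟨u, hu⟩ := hs
  have huv : ∀ n : ℕ, ((u ^ n : Aˣ) : A) • v = v ∧ 
      ((u ^ n : Aˣ) : A) • (a • v) = a • v + ((n : ℂ) * s) • v := by
    intro n
    induction n with
    | zero => simp
    | succ n ih =>
      have h1 : (u : A) • v = v := by
        rw [hu, add_smul, one_smul, smul_assoc, hbv, smul_zero, add_zero]
      have h2 : (u : A) • (a • v) = a • v + s • v := by
        rw [hu, add_smul, one_smul, smul_assoc, hbw]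
      rw [pow_succ, Units.val_mul, mul_smul, mul_smul, h1, h2, smul_add, smul_comm _ s v, ih.1,
        ih.2]
      refine ⟨rfl, ?_⟩
      rw [add_assoc, ← add_smul]
      push_cast
      ring_nf
  have hle : ∀ n : ℕ, ((n * ‖s‖₊ : NNReal) : ENNReal) ≤
      spectralRadius ℂ a + spectralRadius ℂ a := by
    intro n
    obtain ⟨h1, h2⟩ := huv n
    set w := u ^ n
    have h3 : ((w⁻¹ : Aˣ) : A) • v = v := by
      nth_rewrite 1 [← h1]
      rw [← mul_smul]; simp
    have h4 : (a + -((w : A) * a * ((w⁻¹ : Aˣ) : A))) • v = (-((n : ℂ) * s)) • v := by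
      rw [add_smul, neg_smul, mul_smul, mul_smul, h3, h2, neg_smul]
      abel
    have h5 := (nnnorm_le_spectralRadius_of_smul_eq M hv h4).trans (h _)
    rw [spectralRadius_neg] at h5
    have h6 : spectralRadius ℂ ((w : A) * a * ((w⁻¹ : Aˣ) : A)) = spectralRadius ℂ a := by
      simp only [spectralRadius, spectrum.units_conjugate]
    rw [h6] at h5
    simpa using h5
  obtain ⟨K, hK⟩ : ∃ K : NNReal, (K : ENNReal) = spectralRadius ℂ a + spectralRadius ℂ a :=
    ⟨_, ENNReal.coe_toNNReal
      (ENNReal.add_ne_top.2 ⟨spectralRadius_ne_top a, spectralRadius_ne_top a⟩)⟩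
  simp only [← hK, ENNReal.coe_le_coe] at hle
  obtain ⟨n, hn⟩ := exists_nat_gt (K / ‖s‖₊)
  have hpos : 0 < ‖s‖₊ := nnnorm_pos.2 hs0
  rw [div_lt_iff₀ hpos] at hn
  exact absurd (hle n) (not_le.2 hn)

theorem mem_jacobson_bot_iff_smul_eq_zero {A : Type*} [Ring A] {a : A} :
    a ∈ Ideal.jacobson (⊥ : Ideal A) ↔
      ∀ M : Ideal A, M.IsMaximal → ∀ v : A ⧸ M, a • v = 0 := by
  constructor
  · intro ha M hM v
    obtain ⟨x, rfl⟩ := Submodule.Quotient.mk_surjective M v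
    rw [← Submodule.Quotient.mk_smul, Submodule.Quotient.mk_eq_zero, smul_eq_mul]
    have : a * x ∈ Ideal.jacobson (⊥ : Ideal A) := Ideal.mul_mem_right x _ ha
    exact (Ideal.mem_sInf.1 this) ⟨bot_le, hM⟩
  · intro h
    refine Ideal.mem_sInf.2 fun {M} hM ↦ ?_
    have := h M hM.2 (Submodule.Quotient.mk 1)
    rwa [← Submodule.Quotient.mk_smul, Submodule.Quotient.mk_eq_zero, smul_eq_mul, mul_one] at this

theorem mem_jacobson_bot_of_spectralRadius_add_le {A : Type*} [NormedRing A] [NormedAlgebra ℂ A]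
    [CompleteSpace A] {a : A}
    (h : ∀ x, spectralRadius ℂ (a + x) ≤ spectralRadius ℂ a + spectralRadius ℂ x)
    (ha : spectralRadius ℂ a = 0) : a ∈ Ideal.jacobson (⊥ : Ideal A) := by
  refine mem_jacobson_bot_iff_smul_eq_zero.2 fun M hM v ↦ ?_
  obtain ⟨c, hc⟩ := exists_smul_eq_of_spectralRadius_add_le h M v
  by_contra hv
  have hv0 : v ≠ 0 := by rintro rfl; simp at hv
  have := nnnorm_le_spectralRadius_of_smul_eq M hv0 hc
  rw [ha] at this
  have hc0 : c = 0 := by simpa using this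
  simp [hc, hc0] at hv

theorem mem_center_of_spectralRadius_add_le {A : Type*} [NormedRing A] [NormedAlgebra ℂ A]
    [CompleteSpace A] (hA : Ideal.jacobson (⊥ : Ideal A) = ⊥) {a : A}
    (h : ∀ x, spectralRadius ℂ (a + x) ≤ spectralRadius ℂ a + spectralRadius ℂ x) :
    a ∈ Set.center A := by
  rw [Semigroup.mem_center_iff]
  intro b
  rw [← sub_eq_zero, ← Ideal.mem_bot, ← hA, mem_jacobson_bot_iff_smul_eq_zero]
  intro M hM v
  let f : (A ⧸ M) →ₗ[ℂ] (A ⧸ M) :=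
    { toFun := fun v ↦ a • v
      map_add' := fun v w ↦ smul_add _ _ _
      map_smul' := fun c v ↦ smul_comm _ _ _ }
  obtain ⟨c, hc⟩ := LinearMap.exists_eq_smul_id_of_forall_notLinearIndependent (f := f) fun v ↦ by
    obtain ⟨c, hc⟩ := exists_smul_eq_of_spectralRadius_add_le h M v
    intro hli
    have := LinearIndependent.pair_iff.1 hli c (-1) (by simp [f, hc])
    simp at this
  have hf : ∀ v : A ⧸ M, a • v = c • v := fun v ↦ LinearMap.congr_fun hc v
  rw [sub_smul, mul_smul, mul_smul, hf, hf, smul_comm, sub_self]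

theorem spectralRadius_add_of_mem_jacobson_bot {A : Type*} [NormedRing A] [NormedAlgebra ℂ A]
    {a : A} (ha : a ∈ Ideal.jacobson (⊥ : Ideal A)) (x : A) :
    spectralRadius ℂ (a + x) = spectralRadius ℂ x := by
  have hu : ∀ b ∈ Ideal.jacobson (⊥ : Ideal A), IsUnit (1 - b) := by
    have hl : ∀ b ∈ Ideal.jacobson (⊥ : Ideal A), ∃ z, z * (1 - b) = 1 := by
      intro b hb
      obtain ⟨z, hz⟩ := Ideal.mem_jacobson_iff.1 hb (-1)
      rw [Ideal.mem_bot] at hz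
      refine ⟨z, ?_⟩
      rw [← sub_eq_zero, ← hz]
      noncomm_ring
    intro b hb
    obtain ⟨z, hz⟩ := hl b hb
    have hz' : z = 1 - (-(z * b)) := by 
      rw [← sub_eq_zero, ← sub_eq_zero.2 hz]
      noncomm_ring
    obtain ⟨y, hy⟩ := hl (-(z * b)) (neg_mem (Ideal.mul_mem_left _ z hb))
    rw [← hz'] at hy
    have : y = 1 - b := left_inv_eq_right_inv hy hz
    exact ⟨⟨1 - b, z, this ▸ hy, hz⟩, rfl⟩
  have hs : ∀ b ∈ Ideal.jacobson (⊥ : Ideal A), ∀ x : A, spectrum ℂ (b + x) ⊆ spectrum ℂ x := by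
    intro b hb x k hk hkx
    refine hk ?_
    obtain ⟨u, hu'⟩ := hkx
    have : algebraMap ℂ A k - (b + x) = u * (1 - (↑u⁻¹ : A) * b) := by
      rw [mul_sub, ← mul_assoc, Units.mul_inv, hu']
      noncomm_ring
    rw [spectrum.mem_resolventSet_iff, this]
    exact u.isUnit.mul (hu _ (Ideal.mul_mem_left _ _ hb))
  have : spectrum ℂ (a + x) = spectrum ℂ x :=
    (hs a ha x).antisymm (by simpa using hs (-a) (neg_mem ha) (a + x))
  simp only [spectralRadius, this]

theorem Subalgebra.exists_algHom_continuousMap_norm_eq.{u} {A : Type u} [NormedRing A]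
    [NormedAlgebra ℂ A] [CompleteSpace A] (S : Subalgebra ℂ A) (hS : IsClosed (S : Set A))
    (hcomm : ∀ x ∈ S, ∀ y ∈ S, x * y = y * x) :
    ∃ (K : Type u) (_ : TopologicalSpace K) (_ : CompactSpace K) (G : S →ₐ[ℂ] C(K, ℂ)),
      ∀ x : S, (‖G x‖₊ : ENNReal) = spectralRadius ℂ (x : A) := by
  let _ : NormedCommRing S :=
    { (inferInstance : NormedRing S) with
      mul_comm := fun x y ↦ Subtype.ext (hcomm _ x.2 _ y.2) }
  let _ : NormedAlgebra ℂ S := S.toNormedAlgebra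
  have : CompleteSpace S := hS.completeSpace_coe
  refine ⟨WeakDual.characterSpace ℂ S, inferInstance, inferInstance,
    WeakDual.gelfandTransform ℂ S, fun x ↦ ?_⟩
  rw [← IsStarNormal.spectralRadius_eq_nnnorm]
  have h1 : spectralRadius ℂ (WeakDual.gelfandTransform ℂ S x) = spectralRadius ℂ x := by
    simp only [spectralRadius, spectrum.gelfandTransform_eq]
  rw [h1]
  refine tendsto_nhds_unique (spectrum.pow_nnnorm_pow_one_div_tendsto_nhds_spectralRadius x) ?_
  exact spectrum.pow_nnnorm_pow_one_div_tendsto_nhds_spectralRadius (x : A)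

theorem spectralRadius_add_le_of_commute {A : Type*} [NormedRing A]
    [NormedAlgebra ℂ A] [CompleteSpace A] {a b : A} (h : Commute a b) :
    spectralRadius ℂ (a + b) ≤ spectralRadius ℂ a + spectralRadius ℂ b := by
  let S := Subalgebra.centralizer ℂ (Set.centralizer ({a, b} : Set A))
  have hab : ∀ x ∈ ({a, b} : Set A), ∀ y ∈ ({a, b} : Set A), x * y = y * x := by
    rintro x (rfl | rfl) y (rfl | rfl)
    exacts [rfl, h, h.symm, rfl]
  obtain ⟨K, _, _, G, hG⟩ := S.exists_algHom_continuousMap_norm_eq (Set.isClosed_centralizer _)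
    fun x hx y hy ↦ Set.centralizer_centralizer_comm_of_comm hab _ hx _ hy
  have haS : a ∈ S := Set.subset_centralizer_centralizer (by simp)
  have hbS : b ∈ S := Set.subset_centralizer_centralizer (by simp)
  have h1 := hG ⟨a, haS⟩
  have h2 := hG ⟨b, hbS⟩
  have h3 := hG (⟨a, haS⟩ + ⟨b, hbS⟩)
  simp only [AddMemClass.mk_add_mk] at h3
  rw [← h1, ← h2, ← h3, ← AddMemClass.mk_add_mk, map_add, ← ENNReal.coe_add, ENNReal.coe_le_coe]
  exact nnnorm_add_le _ _

/-- The real parts of the states of a function algebra, the latter being given by a representation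
`G` on a compact space. -/
def functionStates {P K : Type*} [Ring P] [Algebra ℂ P] [TopologicalSpace K] [CompactSpace K]
    (G : P →ₐ[ℂ] C(K, ℂ)) : Set (P → ℝ) :=
  {φ | (∀ f g, φ (f + g) = φ f + φ g) ∧ (∀ (c : ℝ) f, φ (c • f) = c * φ f) ∧
    (∀ f, |φ f| ≤ ‖G f‖) ∧ φ 1 = 1}

theorem isCompact_functionStates {P K : Type*} [Ring P] [Algebra ℂ P] [TopologicalSpace K]
    [CompactSpace K] (G : P →ₐ[ℂ] C(K, ℂ)) : IsCompact (functionStates G) := by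
  refine (isCompact_univ_pi fun f ↦ isCompact_Icc (a := -‖G f‖) (b := ‖G f‖)).of_isClosed_subset
    ?_ fun φ hφ f _ ↦ abs_le.1 (hφ.2.2.1 f)
  simp only [functionStates, Set.ofPred_and, Set.ofPred_forall]
  refine IsClosed.inter ?_ (IsClosed.inter ?_ (IsClosed.inter ?_ ?_))
  · exact isClosed_iInter fun f ↦ isClosed_iInter fun g ↦ isClosed_eq (by fun_prop) (by fun_prop)
  · exact isClosed_iInter fun f ↦ isClosed_iInter fun g ↦ isClosed_eq (by fun_prop) (by fun_prop)
  · exact isClosed_iInter fun f ↦ isClosed_le (by fun_prop) (by fun_prop)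
  · exact isClosed_eq (by fun_prop) (by fun_prop)

theorem convex_functionStates {P K : Type*} [Ring P] [Algebra ℂ P] [TopologicalSpace K]
    [CompactSpace K] (G : P →ₐ[ℂ] C(K, ℂ)) : Convex ℝ (functionStates G) := by
  rintro φ ⟨h1, h2, h3, h4⟩ ψ ⟨k1, k2, k3, k4⟩ s t hs ht hst
  refine ⟨fun f g ↦ ?_, fun c f ↦ ?_, fun f ↦ ?_, ?_⟩
  · simp [h1, k1]; ring
  · simp [h2, k2]; ring
  · simp only [Pi.add_apply, Pi.smul_apply, smul_eq_mul]
    refine (abs_add_le _ _).trans ?_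
    rw [abs_mul, abs_mul, abs_of_nonneg hs, abs_of_nonneg ht]
    have := h3 f
    have := k3 f
    calc _ ≤ s * ‖G f‖ + t * ‖G f‖ := by gcongr
      _ = ‖G f‖ := by rw [← add_mul, hst, one_mul]
  · simp [h4, k4, hst]

theorem re_eval_mem_functionStates {P K : Type*} [Ring P] [Algebra ℂ P] [TopologicalSpace K]
    [CompactSpace K] (G : P →ₐ[ℂ] C(K, ℂ)) (x : K) :
    (fun f ↦ (G f x).re) ∈ functionStates G := by
  refine ⟨fun f g ↦ by simp, fun c f ↦ ?_, fun f ↦ ?_, by simp⟩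
  · simp [G.map_smul_of_tower c f]
  · exact (Complex.abs_re_le_norm _).trans ((G f).norm_coe_le_norm x)

theorem exists_extension_of_mem_functionStates {P K : Type*} [Ring P] [Algebra ℂ P]
    [TopologicalSpace K] [CompactSpace K] {G : P →ₐ[ℂ] C(K, ℂ)} (hG : Function.Injective G)
    {φ : P → ℝ} (hφ : φ ∈ functionStates G) :
    ∃ Φ : C(K, ℂ) →ₗ[ℝ] ℝ, (∀ F, Φ F ≤ ‖F‖) ∧ ∀ f, Φ (G f) = φ f := by
  obtain ⟨h1, h2, h3, h4⟩ := hφ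
  let φl : P →ₗ[ℝ] ℝ := { toFun := φ, map_add' := h1, map_smul' := h2 }
  let Gl : P →ₗ[ℝ] C(K, ℂ) :=
    { toFun := G, map_add' := map_add G
      map_smul' := fun c f ↦ G.map_smul_of_tower c f }
  let e := LinearEquiv.ofInjective Gl hG
  have he : ∀ f, (e f : C(K, ℂ)) = G f := fun f ↦ rfl
  let g : StrongDual ℝ (LinearMap.range Gl) := (φl ∘ₗ e.symm.toLinearMap).mkContinuous 1 fun y ↦ by
    obtain ⟨f, rfl⟩ := e.surjective y
    rw [one_mul, LinearMap.comp_apply, LinearEquiv.coe_coe, LinearEquiv.symm_apply_apply]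
    exact h3 f
  obtain ⟨Φ, hΦ, hn⟩ := exists_extension_norm_eq _ g
  refine ⟨Φ.toLinearMap, fun F ↦ ?_, fun f ↦ ?_⟩
  · have h5 : ‖Φ‖ ≤ 1 := hn ▸ LinearMap.mkContinuous_norm_le _ zero_le_one _
    exact (le_abs_self _).trans ((Φ.le_opNorm F).trans (by nlinarith [norm_nonneg F]))
  · have := hΦ (e f)
    rw [he] at this
    refine this.trans ?_
    change φl (e.symm (e f)) = φ f
    rw [LinearEquiv.symm_apply_apply]
    rfl

theorem ContinuousMap.nonneg_of_le_norm {K : Type*} [TopologicalSpace K] [CompactSpace K]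
    {Φ : C(K, ℂ) →ₗ[ℝ] ℝ} (hΦ : ∀ F, Φ F ≤ ‖F‖) (h1 : Φ 1 = 1) {F : C(K, ℂ)}
    (hF : ∀ x, 0 ≤ (F x).re) : 0 ≤ Φ F := by
  have key : ∀ ε : ℝ, 0 < ε → -(ε * ‖F‖ ^ 2) ≤ Φ F := by
    intro ε hε
    have hn : ‖1 - ε • F‖ ≤ 1 + ε ^ 2 * ‖F‖ ^ 2 := by
      refine (ContinuousMap.norm_le _ (by positivity)).2 fun x ↦ ?_
      refine abs_le_of_sq_le_sq' ?_ (by positivity) |>.2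
      have h2 : ‖(1 - ε • F) x‖ ^ 2 = 1 - 2 * ε * (F x).re + ε ^ 2 * ‖F x‖ ^ 2 := by
        rw [Complex.sq_norm, Complex.sq_norm, Complex.normSq_apply, Complex.normSq_apply]
        simp
        ring
      have h3 : ‖F x‖ ^ 2 ≤ ‖F‖ ^ 2 := by gcongr; exact F.norm_coe_le_norm x
      rw [h2]
      have h4 : 0 ≤ ε * (F x).re := mul_nonneg hε.le (hF x)
      have h5 : ε ^ 2 * ‖F x‖ ^ 2 ≤ ε ^ 2 * ‖F‖ ^ 2 := by gcongr
      nlinarith [sq_nonneg (ε ^ 2 * ‖F‖ ^ 2), sq_nonneg (ε * ‖F‖)]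
    have h2 := (hΦ (1 - ε • F)).trans hn
    rw [map_sub, h1, map_smul, smul_eq_mul] at h2
    by_contra! h3
    nlinarith
  have ht : Filter.Tendsto (fun ε : ℝ ↦ -(ε * ‖F‖ ^ 2)) (nhdsWithin 0 (Set.Ioi 0)) (nhds 0) := by
    have : Continuous fun ε : ℝ ↦ -(ε * ‖F‖ ^ 2) := by fun_prop
    simpa using (this.tendsto 0).mono_left nhdsWithin_le_nhds
  exact le_of_tendsto ht (Filter.eventually_of_mem self_mem_nhdsWithin fun ε hε ↦ key ε hε)

theorem functionStates_extension_mul {P K : Type*} [Ring P] [Algebra ℂ P]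
    [TopologicalSpace K] [CompactSpace K] {G : P →ₐ[ℂ] C(K, ℂ)}
    {φ : P → ℝ} (hφ : φ ∈ (functionStates G).extremePoints ℝ)
    {Φ : C(K, ℂ) →ₗ[ℝ] ℝ} (hΦ : ∀ F, Φ F ≤ ‖F‖) (hΦG : ∀ f, Φ (G f) = φ f)
    {g : C(K, ℂ)} (hg : ∀ x, (g x).im = 0) (f : P) : Φ (g * G f) = Φ g * φ f := by
  have hΦ1 : Φ 1 = 1 := by rw [← map_one G, hΦG]; exact hφ.1.2.2.2
  have hGs : ∀ (c : ℝ) f, G (c • f) = c • G f := G.map_smul_of_tower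
  have hbound : ∀ g : C(K, ℂ), (∀ x, (g x).im = 0 ∧ 0 ≤ (g x).re) →
      ∀ f, |Φ (g * G f)| ≤ Φ g * ‖G f‖ := by
    intro g hg f
    have hre : ∀ x, |(g x).re * (G f x).re| ≤ ‖G f‖ * (g x).re := by
      intro x
      rw [abs_mul, abs_of_nonneg (hg x).2, mul_comm]
      have := (Complex.abs_re_le_norm _).trans ((G f).norm_coe_le_norm x)
      exact mul_le_mul_of_nonneg_right this (hg x).2
    have hp := ContinuousMap.nonneg_of_le_norm hΦ hΦ1 (F := ‖G f‖ • g + g * G f) fun x ↦ by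
      have := (abs_le.1 (hre x)).1
      simp [(hg x).1]
      linarith
    have hm := ContinuousMap.nonneg_of_le_norm hΦ hΦ1 (F := ‖G f‖ • g - g * G f) fun x ↦ by
      have := (abs_le.1 (hre x)).2
      simp [(hg x).1]
      linarith
    rw [map_add, map_smul, smul_eq_mul] at hp
    rw [map_sub, map_smul, smul_eq_mul] at hm
    exact abs_le.2 ⟨by linarith, by linarith⟩
  have hstate : ∀ g : C(K, ℂ), (∀ x, (g x).im = 0 ∧ 0 ≤ (g x).re) → 0 < Φ g →
      (fun f ↦ (Φ g)⁻¹ * Φ (g * G f)) ∈ functionStates G := by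
    intro g hg hpos
    refine ⟨fun f h ↦ ?_, fun c f ↦ ?_, fun f ↦ ?_, ?_⟩
    · simp [mul_add]
    · simp only [hGs, mul_smul_comm, map_smul, smul_eq_mul]; ring
    · rw [abs_mul, abs_inv, abs_of_pos hpos, inv_mul_le_iff₀ hpos]
      exact hbound g hg f
    · simp [hpos.ne']
  have hunit : ∀ g : C(K, ℂ), (∀ x, (g x).im = 0 ∧ 0 ≤ (g x).re ∧ (g x).re ≤ 1) →
      ∀ f, Φ (g * G f) = Φ g * φ f := by
    intro g hg f
    have hg0 : ∀ x, (g x).im = 0 ∧ 0 ≤ (g x).re := fun x ↦ ⟨(hg x).1, (hg x).2.1⟩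
    have hg1 : ∀ x, ((1 - g) x).im = 0 ∧ 0 ≤ ((1 - g) x).re := fun x ↦ by
      simp [(hg x).1, (hg x).2.2]
    have hs : Φ (g * G f) + Φ ((1 - g) * G f) = φ f := by
      rw [← map_add, ← add_mul, add_sub_cancel, one_mul, hΦG]
    have hs1 : Φ g + Φ (1 - g) = 1 := by rw [← map_add, add_sub_cancel, hΦ1]
    have hb0 := hbound g hg0 f
    have hb1 := hbound (1 - g) hg1 f
    rcases (ContinuousMap.nonneg_of_le_norm hΦ hΦ1 fun x ↦ (hg0 x).2).eq_or_lt with h0 | h0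
    · rw [← h0, zero_mul] at hb0 ⊢
      exact abs_nonpos_iff.1 hb0
    rcases (ContinuousMap.nonneg_of_le_norm hΦ hΦ1 fun x ↦ (hg1 x).2).eq_or_lt with h1 | h1
    · rw [← h1, zero_mul] at hb1
      rw [abs_nonpos_iff.1 hb1, add_zero] at hs
      rw [← h1, add_zero] at hs1
      rw [hs, hs1, one_mul]
    have := hφ.2 (hstate g hg0 h0) (hstate (1 - g) hg1 h1)
      ⟨Φ g, Φ (1 - g), h0, h1, hs1, by
        ext f
        simp only [Pi.add_apply, Pi.smul_apply, smul_eq_mul]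
        rw [mul_inv_cancel_left₀ h0.ne', mul_inv_cancel_left₀ h1.ne',
          ← map_add, ← add_mul, add_sub_cancel, one_mul, hΦG]⟩
    rw [← this, mul_inv_cancel_left₀ h0.ne']
  have hN : (0 : ℝ) < ‖g‖ + 1 := by positivity
  have h := hunit ((2 * (‖g‖ + 1))⁻¹ • g + (2⁻¹ : ℝ) • 1) (fun x ↦ by
    have h1 := abs_le.1 ((Complex.abs_re_le_norm _).trans (g.norm_coe_le_norm x))
    have h2 : (2 * (‖g‖ + 1))⁻¹ * (g x).re = ((g x).re / (‖g‖ + 1)) / 2 := by field_simp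
    have h3 : (g x).re / (‖g‖ + 1) ≤ 1 := by rw [div_le_one hN]; linarith
    have h4 : -1 ≤ (g x).re / (‖g‖ + 1) := by rw [le_div_iff₀ hN]; linarith
    have hre : (((2 * (‖g‖ + 1))⁻¹ • g + (2⁻¹ : ℝ) • (1 : C(K, ℂ))) x).re =
        ((g x).re / (‖g‖ + 1)) / 2 + 2⁻¹ := by
      rw [← h2]
      simp only [ContinuousMap.add_apply, ContinuousMap.smul_apply, ContinuousMap.one_apply,
        Complex.add_re, Complex.real_smul, Complex.re_ofReal_mul, Complex.ofReal_re,
        mul_one]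
    refine ⟨?_, by rw [hre]; linarith, by rw [hre]; linarith⟩
    simp only [ContinuousMap.add_apply, ContinuousMap.smul_apply, ContinuousMap.one_apply,
        Complex.add_im, Complex.real_smul, Complex.im_ofReal_mul, Complex.one_im, hg, mul_zero,
        add_zero]) f
  rw [add_mul, smul_mul_assoc, smul_mul_assoc, one_mul, map_add, map_add, map_smul, map_smul,
    map_smul, map_smul, hΦ1, hΦG] at h
  simp only [smul_eq_mul] at h
  have h2 : (2 * (‖g‖ + 1))⁻¹ ≠ 0 := by positivity
  refine mul_left_cancel₀ h2 ?_
  linarith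

theorem exists_algHom_of_mem_extremePoints_functionStates {P K : Type*} [Ring P] [Algebra ℂ P]
    [TopologicalSpace K] [CompactSpace K] {G : P →ₐ[ℂ] C(K, ℂ)} (hG : Function.Injective G)
    {φ : P → ℝ} (hφ : φ ∈ (functionStates G).extremePoints ℝ) :
    ∃ χ : P →ₐ[ℂ] ℂ, ∀ f, φ f = (χ f).re := by
  obtain ⟨Φ, hΦ, hΦG⟩ := exists_extension_of_mem_functionStates hG hφ.1
  have hΦ1 : Φ 1 = 1 := by rw [← map_one G, hΦG]; exact hφ.1.2.2.2
  have hI : φ (Complex.I • 1) = 0 := by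
    rw [← hΦG, map_smul, map_one]
    have h1 := ContinuousMap.nonneg_of_le_norm hΦ hΦ1 (F := Complex.I • 1) (by simp)
    have h2 := ContinuousMap.nonneg_of_le_norm hΦ hΦ1 (F := -(Complex.I • 1)) (by simp)
    rw [map_neg] at h2
    linarith
  obtain ⟨hadd, hsmul, -, hone⟩ := hφ.1
  have hneg : ∀ f, φ (-f) = -φ f := fun f ↦ by simpa using hsmul (-1) f
  have hII : ∀ f, φ (Complex.I • Complex.I • f) = -φ f := fun f ↦ by
    rw [smul_smul, Complex.I_mul_I, neg_one_smul, hneg]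
  have hmul : ∀ f h, φ (f * h) = φ f * φ h - φ (Complex.I • f) * φ (Complex.I • h) := by
    intro f
    let g₁ : C(K, ℂ) := ⟨fun x ↦ ((G f x).re : ℂ), by fun_prop⟩
    let g₂ : C(K, ℂ) := ⟨fun x ↦ ((G f x).im : ℂ), by fun_prop⟩
    have hg : G f = g₁ + Complex.I • g₂ := by
      ext x
      simp [g₁, g₂, mul_comm Complex.I, Complex.re_add_im]
    have key : ∀ h, φ (f * h) = Φ g₁ * φ h + Φ g₂ * φ (Complex.I • h) := by
      intro h
      rw [← functionStates_extension_mul hφ hΦ hΦG (g := g₁) (by simp [g₁]),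
        ← functionStates_extension_mul hφ hΦ hΦG (g := g₂) (by simp [g₂]), ← hΦG, ← map_add,
        map_mul, hg, map_smul, add_mul, smul_mul_assoc, mul_smul_comm]
    have k1 := key 1
    have k2 := key (Complex.I • 1)
    rw [mul_one, hone, hI] at k1
    rw [mul_smul_comm, mul_one, hI, hII, hone] at k2
    intro h
    rw [key h, k1, k2]
    ring
  have hc : ∀ (c : ℂ) f, φ (c • f) = c.re * φ f + c.im * φ (Complex.I • f) := by
    intro c f
    conv_lhs => rw [← Complex.re_add_im c, add_smul, mul_smul, hadd, Complex.coe_smul,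
      Complex.coe_smul, hsmul, hsmul]
  refine ⟨AlgHom.ofLinearMap
    { toFun := fun f ↦ ⟨φ f, -φ (Complex.I • f)⟩
      map_add' := fun f h ↦ ?_
      map_smul' := fun c f ↦ ?_ } ?_ ?_, fun f ↦ rfl⟩
  · apply Complex.ext
    · simp [hadd]
    · simp [hadd]; ring
  · apply Complex.ext
    · simp [hc c]
    · simp only [smul_comm Complex.I c, hc c, hII]
      simp; ring
  · apply Complex.ext
    · simp [hone]
    · simp [hI]
  · intro f h
    apply Complex.ext
    · simp [hmul]
    · simp only [LinearMap.coe_mk, AddHom.coe_mk, Complex.mul_im]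
      rw [← smul_mul_assoc, hmul, hII]
      ring

theorem comp_mem_extremePoints_functionStates {P Q K L : Type*} [Ring P] [Algebra ℂ P] [Ring Q]
    [Algebra ℂ Q] [TopologicalSpace K] [CompactSpace K] [TopologicalSpace L] [CompactSpace L]
    {G : P →ₐ[ℂ] C(K, ℂ)} {H : Q →ₐ[ℂ] C(L, ℂ)} (U : P ≃ₗ[ℝ] Q) (hU : ∀ f, ‖H (U f)‖ = ‖G f‖)
    (hU1 : U 1 = 1) {φ : Q → ℝ} (hφ : φ ∈ (functionStates H).extremePoints ℝ) :
    φ ∘ U ∈ (functionStates G).extremePoints ℝ := by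
  refine ⟨?_, ?_⟩
  · obtain ⟨h1, h2, h3, h4⟩ := hφ.1
    exact ⟨fun f g ↦ by simp [h1], fun c f ↦ by simp [h2], fun f ↦ hU f ▸ h3 (U f),
      by simp [hU1, h4]⟩
  · have hsymm : ∀ φ ∈ functionStates G, φ ∘ U.symm ∈ functionStates H := by
      rintro φ ⟨h1, h2, h3, h4⟩
      refine ⟨fun f g ↦ by simp [h1], fun c f ↦ by simp [h2], fun f ↦ ?_, ?_⟩
      · simpa [← hU] using h3 (U.symm f)
      · rw [← hU1]; simp [h4]
    rintro φ₁ h₁ φ₂ h₂ ⟨a, b, ha, hb, hab, h⟩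
    have := hφ.2 (hsymm φ₁ h₁) (hsymm φ₂ h₂) ⟨a, b, ha, hb, hab, by
      ext f
      simpa using congrFun h (U.symm f)⟩
    rw [← this]
    ext f
    simp

theorem eq_zero_of_forall_extremePoints_functionStates {P K : Type*} [Ring P] [Algebra ℂ P]
    [TopologicalSpace K] [CompactSpace K] {G : P →ₐ[ℂ] C(K, ℂ)} (hG : Function.Injective G) {f : P}
    (h : ∀ χ : P →ₐ[ℂ] ℂ, (fun f ↦ (χ f).re) ∈ (functionStates G).extremePoints ℝ → χ f = 0) :
    f = 0 := by
  have key : ∀ g : P, (∀ φ ∈ (functionStates G).extremePoints ℝ, φ g = 0) →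
      ∀ x, (G g x).re = 0 := by
    intro g hg x
    have hx := re_eval_mem_functionStates G x
    rw [← closure_convexHull_extremePoints (isCompact_functionStates G)
      (convex_functionStates G)] at hx
    have hc : Convex ℝ {φ : P → ℝ | φ g = 0} :=
      fun φ hφ ψ hψ s t _ _ _ ↦ by simp_all
    have hcl : IsClosed {φ : P → ℝ | φ g = 0} := isClosed_eq (by fun_prop) (by fun_prop)
    exact closure_minimal (convexHull_min hg hc) hcl hx
  refine hG ?_
  rw [map_zero]
  ext x
  refine Complex.ext (key f (fun φ hφ ↦ ?_) x) ?_
  · obtain ⟨χ, hχ⟩ := exists_algHom_of_mem_extremePoints_functionStates hG hφ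
    obtain rfl : φ = fun f ↦ (χ f).re := funext hχ
    simp [h χ hφ]
  · have := key (Complex.I • f) (fun φ hφ ↦ ?_) x
    · simpa using this
    · obtain ⟨χ, hχ⟩ := exists_algHom_of_mem_extremePoints_functionStates hG hφ
      obtain rfl : φ = fun f ↦ (χ f).re := funext hχ
      simp [h χ hφ]

theorem algHom_eq_of_re_add_im_eq {P : Type*} [Ring P] [Algebra ℂ P] {χ₁ χ₂ χ₃ : P →ₐ[ℂ] ℂ}
    (h : ∀ f, 3 * (χ₁ f).re + 4 * (χ₂ f).im = 3 * (χ₃ f).re + 4 * (χ₃ f).im) : χ₁ = χ₂ := by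
  have key : ∀ f, 3 * χ₁ f - 4 * Complex.I * χ₂ f = (3 - 4 * Complex.I) * χ₃ f := by
    intro f
    have h1 := h f
    have h2 := h (Complex.I • f)
    simp only [map_smul, smul_eq_mul, Complex.I_mul_re, Complex.I_mul_im] at h2
    apply Complex.ext
    · simp; linarith
    · simp; linarith
  ext f
  have h1 := key f
  have h2 := key (f * f)
  simp only [map_mul] at h2
  have h3 : (12 * Complex.I) * (χ₁ f - χ₂ f) ^ 2 = 0 := by
    have hI := Complex.I_sq
    linear_combination (-(3 - 4 * Complex.I)) * h2 +
      (3 * χ₁ f - 4 * Complex.I * χ₂ f + (3 - 4 * Complex.I) * χ₃ f) * h1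
  have h4 : (12 * Complex.I) ≠ 0 := by simp
  have := (mul_eq_zero.1 h3).resolve_left h4
  exact sub_eq_zero.1 (pow_eq_zero_iff two_ne_zero |>.1 this)

/-- A nonlinear version of Nagasawa's theorem. -/
theorem exists_algHom_of_norm_sub_eq {P Q K L : Type*} [Ring P] [Algebra ℂ P] [Ring Q]
    [Algebra ℂ Q] [TopologicalSpace K] [CompactSpace K] [TopologicalSpace L] [CompactSpace L]
    {G : P →ₐ[ℂ] C(K, ℂ)} (hG : Function.Injective G) {H : Q →ₐ[ℂ] C(L, ℂ)}
    (hH : Function.Injective H) {T : P → Q} (hT : Function.Surjective T)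
    (hdist : ∀ f g, ‖H (T f - T g)‖ = ‖G (f - g)‖) (hsmul : ∀ c : ℂ, T (c • 1) = c • 1) :
    ∃ U : P →ₐ[ℂ] Q, ∀ f, U f = T f := by
  have hT0 : T 0 = 0 := by simpa using hsmul 0
  obtain ⟨V, hV⟩ : ∃ V : P ≃ₗ[ℝ] Q, ∀ f, V f = T f := by
    let _ : NormedAddCommGroup P := NormedAddCommGroup.induced P C(K, ℂ) G hG
    let _ : NormedAddCommGroup Q := NormedAddCommGroup.induced Q C(L, ℂ) H hH
    let _ : NormedSpace ℝ P :=
      { norm_smul_le := fun c f ↦ by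
          change ‖G (c • f)‖ ≤ _
          rw [G.map_smul_of_tower]
          exact norm_smul_le c (G f) }
    let _ : NormedSpace ℝ Q :=
      { norm_smul_le := fun c f ↦ by
          change ‖H (c • f)‖ ≤ _
          rw [H.map_smul_of_tower]
          exact norm_smul_le c (H f) }
    have hiso : Isometry T := Isometry.of_dist_eq fun f g ↦ by
      rw [dist_eq_norm, dist_eq_norm]
      exact hdist f g
    let e := (IsometryEquiv.mk (Equiv.ofBijective T ⟨hiso.injective, hT⟩)
      hiso).toRealLinearIsometryEquivOfMapZero hT0
    exact ⟨e.toLinearEquiv, fun f ↦ rfl⟩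
  have hVn : ∀ f, ‖H (V f)‖ = ‖G f‖ := fun f ↦ by simpa [hV, hT0] using hdist f 0
  have rot : ∀ (c d : ℂ), c * d = 1 → ‖d‖ = 1 → ∀ φ ∈ (functionStates H).extremePoints ℝ,
      ∃ χ : P →ₐ[ℂ] ℂ, ∀ f, φ (d • V (c • f)) = (χ f).re := by
    intro c d hcd hd φ hφ
    have hdc : d * c = 1 := by rw [mul_comm, hcd]
    have hc : ‖c‖ = 1 := by simpa [hd] using congrArg norm hcd
    let U : P ≃ₗ[ℝ] Q :=
      { toFun := fun f ↦ d • V (c • f)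
        invFun := fun q ↦ d • V.symm (c • q)
        map_add' := fun f g ↦ by simp only [smul_add, map_add]
        map_smul' := fun t f ↦ by
          rw [smul_comm c t f, map_smul, smul_comm d t, RingHom.id_apply]
        left_inv := fun f ↦ by simp [smul_smul, hcd, hdc]
        right_inv := fun q ↦ by simp [smul_smul, hcd, hdc] }
    have hU : ∀ f, ‖H (U f)‖ = ‖G f‖ := fun f ↦ by
      change ‖H (d • V (c • f))‖ = _
      rw [map_smul, norm_smul, hVn, map_smul, norm_smul, hd, hc, one_mul, one_mul]
    have hU1 : U 1 = 1 := by
      change d • V (c • 1) = 1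
      rw [hV, hsmul, smul_smul, hdc, one_smul]
    exact exists_algHom_of_mem_extremePoints_functionStates hG
      (comp_mem_extremePoints_functionStates U hU hU1 hφ)
  have key : ∀ χ : Q →ₐ[ℂ] ℂ, (fun f ↦ (χ f).re) ∈ (functionStates H).extremePoints ℝ →
      ∃ χ' : P →ₐ[ℂ] ℂ, ∀ f, χ (V f) = χ' f := by
    intro χ hχ
    obtain ⟨χ₁, h₁⟩ := rot 1 1 (by simp) (by simp) _ hχ
    obtain ⟨χ₂, h₂⟩ := rot Complex.I (-Complex.I) (by simp) (by simp) _ hχ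
    obtain ⟨χ₃, h₃⟩ := rot ((3 + 4 * Complex.I) / 5) ((3 - 4 * Complex.I) / 5)
      (by linear_combination (-16 / 25) * Complex.I_sq) (by
        rw [Complex.norm_def, Complex.normSq_apply]
        norm_num) _ hχ
    have hre : ∀ f, (χ (V f)).re = (χ₁ f).re := fun f ↦ by simpa using h₁ f
    have him : ∀ f, (χ (V f)).im = (χ₂ f).im := fun f ↦ by
      have := h₂ (-Complex.I • f)
      rw [smul_smul] at this
      simpa using this
    have heq : χ₁ = χ₂ := algHom_eq_of_re_add_im_eq (χ₃ := χ₃) fun f ↦ by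
      have := h₃ (((3 - 4 * Complex.I) / 5) • f)
      have h5 : (3 + 4 * Complex.I) / 5 * ((3 - 4 * Complex.I) / 5) = 1 := by
        linear_combination (-16 / 25) * Complex.I_sq
      rw [smul_smul, h5, one_smul, map_smul, map_smul] at this
      rw [← hre, ← him]
      simp [Complex.mul_re] at this
      linarith
    exact ⟨χ₁, fun f ↦ Complex.ext (hre f) (heq ▸ him f)⟩
  refine ⟨AlgHom.ofLinearMap
    { toFun := V
      map_add' := map_add V
      map_smul' := fun c f ↦ ?_ } ?_ ?_, hV⟩
  · refine sub_eq_zero.1 (eq_zero_of_forall_extremePoints_functionStates hH fun χ hχ ↦ ?_)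
    obtain ⟨χ', h⟩ := key χ hχ
    simp [h]
  · simpa [hV] using hsmul 1
  · intro f g
    refine sub_eq_zero.1 (eq_zero_of_forall_extremePoints_functionStates hH fun χ hχ ↦ ?_)
    obtain ⟨χ', h⟩ := key χ hχ
    simp [h]

theorem spectralRadius_add_self {A : Type*} [NormedRing A] [NormedAlgebra ℂ A] [CompleteSpace A]
    (a : A) : spectralRadius ℂ (a + a) = 2 * spectralRadius ℂ a := by
  refine le_antisymm ?_ ?_
  · rw [two_mul]
    exact spectralRadius_add_le_of_commute (Commute.refl a)
  · simp only [spectralRadius, ENNReal.mul_iSup]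
    refine iSup₂_le fun k hk ↦ ?_
    have hk2 : 2 * k ∈ spectrum ℂ (a + a) := by
      have h := spectrum.unit_smul_eq_smul a (Units.mk0 (2 : ℂ) two_ne_zero)
      have h2 : Units.mk0 (2 : ℂ) two_ne_zero • a = a + a := two_smul ℂ a
      rw [← h2, h]
      exact Set.smul_mem_smul_set hk
    have := le_iSup₂ (f := fun (k : ℂ) (_ : k ∈ spectrum ℂ (a + a)) ↦ (‖k‖₊ : ENNReal)) _ hk2
    simpa using this

theorem eq_of_forall_spectralRadius_add_eq {A : Type*} [NormedRing A] [NormedAlgebra ℂ A]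
    [CompleteSpace A] (hA : Ideal.jacobson (⊥ : Ideal A) = ⊥) {x y : A}
    (h : ∀ z, spectralRadius ℂ (x + z) = spectralRadius ℂ (y + z)) : x = y := by
  have key : ∀ w, spectralRadius ℂ (x - y + w) = spectralRadius ℂ w := fun w ↦ by
    have := h (w - y)
    rwa [add_sub_cancel, add_sub_left_comm, add_comm w] at this
  have h0 : spectralRadius ℂ (x - y) = 0 := by simpa using key 0
  have hmem := mem_jacobson_bot_of_spectralRadius_add_le (a := x - y)
    (fun w ↦ by rw [key, h0, zero_add]) h0
  rw [hA] at hmem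
  exact sub_eq_zero.1 hmem

theorem eq_zero_of_mem_center_of_spectralRadius_eq_zero {A : Type*} [NormedRing A]
    [NormedAlgebra ℂ A] [CompleteSpace A] (hA : Ideal.jacobson (⊥ : Ideal A) = ⊥) {a : A}
    (ha : a ∈ Set.center A) (h0 : spectralRadius ℂ a = 0) : a = 0 := by
  have hmem := mem_jacobson_bot_of_spectralRadius_add_le (a := a)
    (fun w ↦ spectralRadius_add_le_of_commute (ha.comm w)) h0
  rwa [hA] at hmem

theorem exists_algHom_continuousMap_center.{u} {A : Type u} [NormedRing A] [NormedAlgebra ℂ A]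
    [CompleteSpace A] (hA : Ideal.jacobson (⊥ : Ideal A) = ⊥) :
    ∃ (K : Type u) (_ : TopologicalSpace K) (_ : CompactSpace K)
      (G : Subalgebra.center ℂ A →ₐ[ℂ] C(K, ℂ)), Function.Injective G ∧
        ∀ x, (‖G x‖₊ : ENNReal) = spectralRadius ℂ (x : A) := by
  obtain ⟨K, hK, hK', G, hG⟩ := (Subalgebra.center ℂ A).exists_algHom_continuousMap_norm_eq
    (by
      change IsClosed (Set.center A)
      rw [← Set.centralizer_univ]
      exact Set.isClosed_centralizer _) fun x hx y _ ↦ hx.comm y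
  refine ⟨K, hK, hK', G, (injective_iff_map_eq_zero G).2 fun x hx ↦ Subtype.ext ?_, hG⟩
  refine eq_zero_of_mem_center_of_spectralRadius_eq_zero hA x.2 ?_
  rw [← hG, hx]
  simp

/-- If `A` is semisimple, and `T : A → B` is surjective, satisfies
`T(λ·1 + x) = λ·1 + Tx`, and `r(x+y) = r(Tx+Ty)` for all `x, y`, then `T` maps the
centre of `A` bijectively onto the centre of `B`, and its restriction to the centre
is an algebra isomorphism (additive, complex-homogeneous, unital, multiplicative). -/
theorem restriction_to_center_is_algebra_iso
    {A B : Type*} [NormedRing A] [NormedAlgebra ℂ A] [CompleteSpace A]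
    [NormedRing B] [NormedAlgebra ℂ B] [CompleteSpace B]
    (hA : Ideal.jacobson (⊥ : Ideal A) = ⊥)
    (T : A → B)
    (hsurj : Function.Surjective T)
    (hunit : ∀ (lam : ℂ) (x : A), T (lam • (1 : A) + x) = lam • (1 : B) + T x)
    (hr : ∀ x y : A, spectralRadius ℂ (x + y) = spectralRadius ℂ (T x + T y)) :
    Set.BijOn T (Set.center A) (Set.center B) ∧
      (∀ x ∈ Set.center A, ∀ y ∈ Set.center A, T (x + y) = T x + T y) ∧
      (∀ (c : ℂ), ∀ x ∈ Set.center A, T (c • x) = c • T x) ∧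
      T 1 = 1 ∧
      (∀ x ∈ Set.center A, ∀ y ∈ Set.center A, T (x * y) = T x * T y) := by
  have hrT : ∀ x, spectralRadius ℂ (T x) = spectralRadius ℂ x := fun x ↦ by
    have := hr x x
    rw [spectralRadius_add_self, spectralRadius_add_self] at this
    exact ((ENNReal.mul_right_inj (by simp) (by simp)).1 this).symm
  have hinj : Function.Injective T := fun x y hxy ↦
    eq_of_forall_spectralRadius_add_eq hA fun z ↦ by rw [hr, hr, hxy]
  have hB : Ideal.jacobson (⊥ : Ideal B) = ⊥ := by
    refine (Submodule.eq_bot_iff _).2 fun b hb ↦ ?_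
    obtain ⟨x, hx⟩ := hsurj (b + T 0)
    have hx0 : x = 0 := eq_of_forall_spectralRadius_add_eq hA fun z ↦ by
      rw [hr, hr, hx, add_assoc, spectralRadius_add_of_mem_jacobson_bot hb]
    simpa [hx0] using hx
  have hT0 : T 0 = 0 := eq_of_forall_spectralRadius_add_eq hB fun z ↦ by
    obtain ⟨x, rfl⟩ := hsurj z
    rw [← hr, zero_add, zero_add, hrT]
  have hTsmul : ∀ c : ℂ, T (c • 1) = c • 1 := fun c ↦ by simpa [hT0] using hunit c 0
  have hcenter : ∀ a, a ∈ Set.center A ↔ T a ∈ Set.center B := fun a ↦ by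
    refine ⟨fun ha ↦ mem_center_of_spectralRadius_add_le hB fun z ↦ ?_,
      fun ha ↦ mem_center_of_spectralRadius_add_le hA fun z ↦ ?_⟩
    · obtain ⟨x, rfl⟩ := hsurj z
      rw [← hr, hrT, hrT]
      exact spectralRadius_add_le_of_commute (ha.comm x)
    · rw [hr, ← hrT a, ← hrT z]
      exact spectralRadius_add_le_of_commute (ha.comm (T z))
  have hneg : ∀ a ∈ Set.center A, T (-a) = -T a := fun a ha ↦ by
    have ha' : T (-a) ∈ Set.center B := (hcenter _).1 (Set.neg_mem_center ha)
    refine eq_neg_of_add_eq_zero_left (eq_zero_of_mem_center_of_spectralRadius_eq_zero hB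
      (Set.add_mem_center ha' ((hcenter a).1 ha)) ?_)
    rw [← hr, neg_add_cancel, spectrum.spectralRadius_zero]
  obtain ⟨K, _, _, G, hGinj, hG⟩ := exists_algHom_continuousMap_center hA
  obtain ⟨L, _, _, H, hHinj, hH⟩ := exists_algHom_continuousMap_center hB
  let S : Subalgebra.center ℂ A → Subalgebra.center ℂ B := fun a ↦ ⟨T a, (hcenter a).1 a.2⟩
  have hS : Function.Surjective S := fun b ↦ by
    obtain ⟨a, ha⟩ := hsurj b
    exact ⟨⟨a, (hcenter a).2 (ha ▸ b.2)⟩, Subtype.ext ha⟩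
  obtain ⟨U, hU⟩ := exists_algHom_of_norm_sub_eq hGinj hHinj hS (fun f g ↦ by
    have h : (‖H (S f - S g)‖₊ : ENNReal) = ‖G (f - g)‖₊ := by
      rw [hH, hG]
      change spectralRadius ℂ (T f - T g) = spectralRadius ℂ ((f : A) - g)
      rw [sub_eq_add_neg, ← hneg g g.2, ← hr, sub_eq_add_neg]
    exact congrArg NNReal.toReal (ENNReal.coe_injective h)) fun c ↦ Subtype.ext (hTsmul c)
  have hUT : ∀ a : Subalgebra.center ℂ A, T a = U a := fun a ↦ by rw [hU]
  refine ⟨⟨fun a ha ↦ (hcenter a).1 ha, hinj.injOn, fun b hb ↦ ?_⟩, fun x hx y hy ↦ ?_,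
    fun c x hx ↦ ?_, ?_, fun x hx y hy ↦ ?_⟩
  · obtain ⟨a, rfl⟩ := hsurj b
    exact ⟨a, (hcenter a).2 hb, rfl⟩
  · have h : (U (⟨x, hx⟩ + ⟨y, hy⟩) : B) = U ⟨x, hx⟩ + U ⟨y, hy⟩ := by simp
    rwa [← hUT, ← hUT, ← hUT] at h
  · have h : (U (c • ⟨x, hx⟩) : B) = c • (U ⟨x, hx⟩ : B) := by simp
    rwa [← hUT, ← hUT] at h
  · simpa using hTsmul 1
  · have h : (U (⟨x, hx⟩ * ⟨y, hy⟩) : B) = U ⟨x, hx⟩ * U ⟨y, hy⟩ := by simp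
    rwa [← hUT, ← hUT, ← hUT] at h
end

section
/- Let A and B be complex unital Banach algebras and let T : A → B be a surjective additive map that preserves the spectral radius, i.e. r(Tx) = r(x) for all x ∈ A. Define the separating space 𝒮(T) = { y ∈ B : there is a sequence (xₙ) in A with xₙ → 0 and Txₙ → y }. Then for every b ∈ 𝒮(T) and every y ∈ B one has r(y) ≤ r(b + y). In particular, every element of 𝒮(T) is quasinilpotent, i.e. r(b) = 0 for all b ∈ 𝒮(T). -/
section

open MeasureTheory Filter Topology Real Metric
open scoped ENNReal

theorem log_norm_le_circleAverage_log_norm {f : ℂ → ℂ} (hf : Differentiable ℂ f) (h0 : f 0 ≠ 0) :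
    log ‖f 0‖ ≤ circleAverage (fun z ↦ log ‖f z‖) 0 1 := by
  have hf' : AnalyticOnNhd ℂ f (closedBall 0 |1|) := fun z _ ↦ hf.analyticAt z
  rw [hf'.circleAverage_log_norm one_ne_zero h0]
  refine le_add_of_nonneg_left (finsum_nonneg fun u ↦ ?_)
  by_cases hu : u ∈ closedBall (0 : ℂ) |1|
  · refine mul_nonneg (mod_cast MeromorphicOn.AnalyticOnNhd.divisor_nonneg hf' u) ?_
    rcases eq_or_ne u 0 with rfl | h
    · simp
    · have hu1 : ‖u‖ ≤ 1 := by simpa using hu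
      simpa using log_nonpos (norm_nonneg u) hu1
  · rw [Function.locallyFinsuppWithin.apply_eq_zero_of_notMem _ hu, Int.cast_zero, zero_mul]

theorem posLog_norm_le_circleAverage {E : Type*} [NormedAddCommGroup E] [NormedSpace ℂ E]
    {f : ℂ → E} (hf : Differentiable ℂ f) :
    log⁺ ‖f 0‖ ≤ circleAverage (fun z ↦ log⁺ ‖f z‖) 0 1 := by
  have hint : CircleIntegrable (fun z ↦ log⁺ ‖f z‖) 0 1 :=
    (continuous_posLog.comp hf.continuous.norm).continuousOn.circleIntegrable zero_le_one
  rw [posLog_apply, max_le_iff]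
  refine ⟨?_, ?_⟩
  · rw [← circleAverage_const (0 : ℝ) 0 1]
    exact circleAverage_mono (circleIntegrable_const _ _ _) hint fun z _ ↦ posLog_nonneg
  obtain ⟨g, hg, hg0⟩ := exists_dual_vector'' ℂ (f 0)
  rcases eq_or_ne (f 0) 0 with h0 | h0
  · rw [h0, norm_zero, log_zero, ← circleAverage_const (0 : ℝ) 0 1]
    exact circleAverage_mono (circleIntegrable_const _ _ _) hint fun z _ ↦ posLog_nonneg
  have hgf : Differentiable ℂ (fun z ↦ g (f z)) := g.differentiable.comp hf
  have h1 : g (f 0) ≠ 0 := by simpa [hg0] using h0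
  have h2 := log_norm_le_circleAverage_log_norm hgf h1
  have h3 : ‖g (f 0)‖ = ‖f 0‖ := by rw [hg0]; simp
  rw [h3] at h2
  refine h2.trans (circleAverage_mono ?_ hint fun z _ ↦ ?_)
  · exact MeromorphicOn.circleIntegrable_log_norm fun z _ ↦ (hgf.analyticAt z).meromorphicAt
  · refine (le_max_right 0 _).trans (posLog_le_posLog (norm_nonneg _) ?_)
    exact (g.le_opNorm _).trans (mul_le_of_le_one_left (norm_nonneg _) hg)

theorem le_integral_of_le_circleAverage {E Ω : Type*} [NormedAddCommGroup E] [NormedSpace ℂ E]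
    [TopologicalSpace Ω] [SecondCountableTopology Ω] [MeasurableSpace Ω] [BorelSpace Ω]
    {μ : Measure Ω} [IsProbabilityMeasure μ] {H : E → ℝ} (hH : Continuous H)
    {t : Ω → E} (ht : Continuous t) (a : E) {C : ℝ}
    (hC : ∀ ζ : ℂ, ‖ζ‖ = 1 → ∀ ω, |H (a + ζ • t ω)| ≤ C)
    (hsub : ∀ z, H a ≤ circleAverage (fun ζ ↦ H (a + ζ • z)) 0 1)
    (hrot : ∀ ζ : ℂ, ‖ζ‖ = 1 → ∫ ω, H (a + ζ • t ω) ∂μ = ∫ ω, H (a + t ω) ∂μ) :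
    H a ≤ ∫ ω, H (a + t ω) ∂μ := by
  have hcont : Continuous fun p : ℝ × Ω ↦ H (a + circleMap 0 1 p.1 • t p.2) := by
    have := continuous_circleMap 0 1
    fun_prop
  have hn (θ : ℝ) : ‖circleMap 0 1 θ‖ = 1 := by simp
  have hbd : ∀ p : ℝ × Ω, ‖H (a + circleMap 0 1 p.1 • t p.2)‖ ≤ C :=
    fun p ↦ hC _ (hn _) _
  have hint : Integrable (fun p : ℝ × Ω ↦ H (a + circleMap 0 1 p.1 • t p.2))
      ((volume.restrict (Set.uIoc 0 (2 * π))).prod μ) := by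
    have : IsFiniteMeasure ((volume : Measure ℝ).restrict (Set.uIoc 0 (2 * π))) :=
      ⟨by simp [Set.uIoc]⟩
    exact Integrable.of_bound hcont.aestronglyMeasurable C (ae_of_all _ hbd)
  calc
    H a = ∫ ω, H a ∂μ := by simp
    _ ≤ ∫ ω, circleAverage (fun ζ ↦ H (a + ζ • t ω)) 0 1 ∂μ := by
      refine integral_mono (integrable_const _) ?_ fun ω ↦ hsub (t ω)
      simp only [circleAverage_def, intervalIntegral.intervalIntegral_eq_integral_uIoc]
      exact (hint.integral_prod_right.smul (if 0 ≤ 2 * π then (1 : ℝ) else -1)).smul (2 * π)⁻¹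
    _ = circleAverage (fun ζ ↦ ∫ ω, H (a + ζ • t ω) ∂μ) 0 1 := by
      simp only [circleAverage_def]
      rw [integral_smul, intervalIntegral_integral_swap hint]
    _ = circleAverage (fun _ ↦ ∫ ω, H (a + t ω) ∂μ) 0 1 := by
      simp only [circleAverage_def, hrot _ (hn _)]
    _ = ∫ ω, H (a + t ω) ∂μ := circleAverage_const _ _ _

theorem spectralRadius_lt_of_norm_pow_lt {A : Type*} [NormedRing A] [NormedAlgebra ℂ A]
    [CompleteSpace A] {x : A} {c : ℝ} {n : ℕ} (hc : 0 < c) (hn : n ≠ 0) (h : ‖x ^ n‖ < c ^ n) :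
    spectralRadius ℂ x < ENNReal.ofReal c := by
  have hroot : ‖x ^ n‖ ^ (1 / n : ℝ) < c := by
    have := Real.rpow_lt_rpow (norm_nonneg _) h (z := 1 / n) (by positivity)
    rwa [one_div, Real.pow_rpow_inv_natCast hc.le hn, ← one_div] at this
  refine lt_of_le_of_lt ?_ ((ENNReal.ofReal_lt_ofReal_iff hc).2 hroot)
  have htend := (spectrum.pow_norm_pow_one_div_tendsto_nhds_spectralRadius x).comp
    (tendsto_id.const_mul_atTop' (Nat.pos_of_ne_zero hn))
  refine le_of_tendsto htend ((eventually_ge_atTop 1).mono fun m hm ↦ ?_)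
  refine ENNReal.ofReal_le_ofReal ?_
  have hm0 : m ≠ 0 := by omega
  calc ‖x ^ (n * m)‖ ^ (1 / ((n * m : ℕ) : ℝ))
      ≤ (‖x ^ n‖ ^ m) ^ (1 / ((n * m : ℕ) : ℝ)) := by
        refine Real.rpow_le_rpow (norm_nonneg _) ?_ (by positivity)
        rw [pow_mul]
        exact norm_pow_le' _ hm
    _ = ‖x ^ n‖ ^ (1 / n : ℝ) := by
        rw [← Real.rpow_natCast, ← Real.rpow_mul (norm_nonneg _)]
        congr 1
        push_cast
        field_simp

theorem exists_norm_pow_two_pow_lt {A : Type*} [NormedRing A] [NormedAlgebra ℂ A]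
    [CompleteSpace A] {x : A} {c : ℝ} (hc : 0 < c) (h : spectralRadius ℂ x < ENNReal.ofReal c) :
    ∃ k : ℕ, ‖x ^ 2 ^ k‖ < c ^ 2 ^ k := by
  have htend := (spectrum.pow_norm_pow_one_div_tendsto_nhds_spectralRadius x).comp
    (tendsto_pow_atTop_atTop_of_one_lt (one_lt_two (α := ℕ)))
  obtain ⟨k, hk⟩ := (htend.eventually_lt_const h).exists
  refine ⟨k, ?_⟩
  have hk' := (ENNReal.ofReal_lt_ofReal_iff hc).1 hk
  rw [one_div] at hk'
  have := pow_lt_pow_left₀ hk' (by positivity) (n := 2 ^ k) (by positivity)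
  rwa [Real.rpow_inv_natCast_pow (norm_nonneg _) (by positivity)] at this

theorem isOpen_setOf_spectralRadius_lt {A : Type*} [NormedRing A] [NormedAlgebra ℂ A]
    [CompleteSpace A] {c : ℝ} (hc : 0 < c) :
    IsOpen {x : A | spectralRadius ℂ x < ENNReal.ofReal c} := by
  have : {x : A | spectralRadius ℂ x < ENNReal.ofReal c}
      = ⋃ k : ℕ, {x : A | ‖x ^ 2 ^ k‖ < c ^ 2 ^ k} := by
    ext x
    simp only [Set.mem_ofPred_eq, Set.mem_iUnion]
    exact ⟨exists_norm_pow_two_pow_lt hc,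
      fun ⟨k, hk⟩ ↦ spectralRadius_lt_of_norm_pow_lt hc (by positivity) hk⟩
  rw [this]
  exact isOpen_iUnion fun k ↦ isOpen_lt (by fun_prop) (by fun_prop)

theorem norm_pow_two_pow_lt_mono {A : Type*} [NormedRing A] {x : A} {c : ℝ} :
    Monotone fun k : ℕ ↦ ‖x ^ 2 ^ k‖ < c ^ 2 ^ k := by
  refine monotone_nat_of_le_succ fun k h ↦ ?_
  rw [pow_succ, pow_mul, pow_mul]
  exact (norm_pow_le' _ two_pos).trans_lt (pow_lt_pow_left₀ h (norm_nonneg _) two_ne_zero)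

theorem map_update_prod_infinitePi {ι : Type*} [DecidableEq ι] {X : ι → Type*}
    [∀ i, MeasurableSpace (X i)] (μ : ∀ i, Measure (X i)) [∀ i, IsProbabilityMeasure (μ i)]
    (m : ι) :
    ((Measure.infinitePi μ).prod (μ m)).map (fun p ↦ Function.update p.1 m p.2)
      = Measure.infinitePi μ := by
  refine Measure.eq_infinitePi _ fun s t ht ↦ ?_
  have hmeas : Measurable fun p : (∀ i, X i) × X m ↦ Function.update p.1 m p.2 :=
    measurable_update'
  rw [Measure.map_apply hmeas (.pi s.countable_toSet fun i _ ↦ ht i)]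
  by_cases hm : m ∈ s
  · have : (fun p : (∀ i, X i) × X m ↦ Function.update p.1 m p.2) ⁻¹' Set.pi s t
        = Set.pi ↑(s.erase m) t ×ˢ t m := by
      ext ⟨x, z⟩
      simp only [Set.mem_preimage, Set.mem_pi, Finset.mem_coe, Set.mem_prod, Finset.mem_erase]
      refine ⟨fun h ↦ ⟨fun i hi ↦ ?_, by simpa using h m hm⟩, fun h i hi ↦ ?_⟩
      · simpa [Function.update_of_ne hi.1] using h i hi.2
      · rcases eq_or_ne i m with rfl | him
        · simpa using h.2
        · simpa [Function.update_of_ne him] using h.1 i ⟨him, hi⟩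
    rw [this, Measure.prod_prod, Measure.infinitePi_pi _ fun i _ ↦ ht i,
      Finset.prod_erase_mul _ _ hm]
  · have : (fun p : (∀ i, X i) × X m ↦ Function.update p.1 m p.2) ⁻¹' Set.pi s t
        = Set.pi s t ×ˢ Set.univ := by
      ext ⟨x, z⟩
      simp only [Set.mem_preimage, Set.mem_pi, Finset.mem_coe, Set.mem_prod, Set.mem_univ,
        and_true]
      refine forall₂_congr fun i hi ↦ ?_
      rw [Function.update_of_ne (ne_of_mem_of_not_mem hi hm)]
    rw [this, Measure.prod_prod, Measure.infinitePi_pi _ fun i _ ↦ ht i, measure_univ, mul_one]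

theorem infinitePi_preimage_update_le {ι : Type*} [DecidableEq ι] {X : ι → Type*}
    [∀ i, MeasurableSpace (X i)] (μ : ∀ i, Measure (X i)) [∀ i, IsProbabilityMeasure (μ i)]
    (m : ι) {f : X m → X m} (hf : Measurable f) {η : ℝ≥0∞}
    (h : ∀ G, MeasurableSet G → μ m (f ⁻¹' G) ≤ μ m G + η)
    {U : Set (∀ i, X i)} (hU : MeasurableSet U) :
    Measure.infinitePi μ ((fun x ↦ Function.update x m (f (x m))) ⁻¹' U)
      ≤ Measure.infinitePi μ U + η := by
  have hmeas : Measurable fun p : (∀ i, X i) × X m ↦ Function.update p.1 m p.2 :=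
    measurable_update'
  have hS : Measurable fun x : ∀ i, X i ↦ Function.update x m (f (x m)) :=
    hmeas.comp (measurable_id.prodMk (hf.comp (measurable_pi_apply m)))
  have hmass {V : Set (∀ i, X i)} (hV : MeasurableSet V) : Measure.infinitePi μ V
      = ∫⁻ x, μ m {z | Function.update x m z ∈ V} ∂(Measure.infinitePi μ) := by
    conv_lhs => rw [← map_update_prod_infinitePi μ m, Measure.map_apply hmeas hV,
      Measure.prod_apply (hmeas hV)]
    rfl
  rw [hmass (hS hU), hmass hU]
  calc
    _ ≤ ∫⁻ x, (μ m {z | Function.update x m z ∈ U} + η) ∂(Measure.infinitePi μ) := by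
      refine lintegral_mono fun x ↦ ?_
      simpa using h {z | Function.update x m z ∈ U} (measurable_update x hU)
    _ = _ := by
      rw [lintegral_add_right _ measurable_const, lintegral_const, measure_univ, mul_one]

/-- The uniform probability measure on the closed unit disc. -/
noncomputable def discMeasure : Measure ℂ := ProbabilityTheory.cond volume (closedBall 0 1)

instance : IsProbabilityMeasure discMeasure :=
  ProbabilityTheory.cond_isProbabilityMeasure_of_finite
    (measure_closedBall_pos volume _ one_pos).ne' measure_closedBall_lt_top.ne

theorem discMeasure_apply (G : Set ℂ) :
    discMeasure G = (volume (closedBall (0 : ℂ) 1))⁻¹ * volume (closedBall 0 1 ∩ G) :=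
  ProbabilityTheory.cond_apply measurableSet_closedBall _ _

theorem map_mul_discMeasure {ζ : ℂ} (hζ : ‖ζ‖ = 1) : discMeasure.map (ζ * ·) = discMeasure := by
  have hmp := (rotation ⟨ζ, by simpa [Submonoid.unitSphere] using hζ⟩).measurePreserving
  ext G hG
  rw [Measure.map_apply (by fun_prop) hG, discMeasure_apply, discMeasure_apply]
  congr 1
  rw [← hmp.measure_preimage (measurableSet_closedBall.inter hG).nullMeasurableSet]
  congr 1
  ext z
  simp
  intro _
  rfl

theorem exists_discMeasure_preimage_add_le {η : ℝ≥0∞} (hη : 0 < η) :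
    ∃ δ₀ > 0, ∀ δ : ℝ, 0 ≤ δ → δ < δ₀ → ∀ G : Set ℂ,
      discMeasure ((· + (δ : ℂ)) ⁻¹' G) ≤ discMeasure G + η := by
  have htend : Tendsto (fun δ : ℝ ↦ ENNReal.ofReal ((1 + δ) ^ 2 - 1)) (𝓝 0) (𝓝 0) := by
    have : Continuous fun δ : ℝ ↦ ENNReal.ofReal ((1 + δ) ^ 2 - 1) :=
      ENNReal.continuous_ofReal.comp (by fun_prop)
    simpa using this.tendsto 0
  obtain ⟨δ₀, hδ₀, h⟩ := Metric.eventually_nhds_iff.1 (htend.eventually_le_const hη)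
  refine ⟨δ₀, hδ₀, fun δ hδ hlt G ↦ ?_⟩
  have hvol : volume (closedBall (0 : ℂ) 1) ≠ 0 :=
    (measure_closedBall_pos volume _ one_pos).ne'
  have hvol' : volume (closedBall (0 : ℂ) 1) ≠ ∞ := measure_closedBall_lt_top.ne
  have hsub : (closedBall (0 : ℂ) 1 ∩ (· + (δ : ℂ)) ⁻¹' G)
      ⊆ (· + (δ : ℂ)) ⁻¹' ((closedBall 0 1 ∩ G) ∪ (closedBall 0 (1 + δ) \ closedBall 0 1)) := by
    rintro z ⟨hz, hzG⟩
    have hz1 : ‖z + δ‖ ≤ 1 + δ := by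
      refine (norm_add_le _ _).trans (add_le_add (by simpa using hz) ?_)
      simp [abs_of_nonneg hδ]
    by_cases h1 : z + δ ∈ closedBall (0 : ℂ) 1
    · exact Or.inl ⟨h1, hzG⟩
    · exact Or.inr ⟨by simpa using hz1, h1⟩
  have hdiff : volume (closedBall (0 : ℂ) (1 + δ) \ closedBall 0 1)
      = ENNReal.ofReal ((1 + δ) ^ 2 - 1) * volume (closedBall (0 : ℂ) 1) := by
    rw [measure_sdiff (closedBall_subset_closedBall (by linarith))
      measurableSet_closedBall.nullMeasurableSet hvol', Complex.volume_closedBall,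
      Complex.volume_closedBall, ENNReal.ofReal_sub _ zero_le_one,
      ENNReal.ofReal_pow (by positivity)]
    simp [ENNReal.sub_mul]
  rw [discMeasure_apply, discMeasure_apply]
  calc
    _ ≤ (volume (closedBall (0 : ℂ) 1))⁻¹ * (volume (closedBall 0 1 ∩ G)
        + ENNReal.ofReal ((1 + δ) ^ 2 - 1) * volume (closedBall (0 : ℂ) 1)) := by
      gcongr
      refine (measure_mono hsub).trans ?_
      rw [measure_preimage_add_right, ← hdiff]
      exact measure_union_le _ _
    _ = (volume (closedBall (0 : ℂ) 1))⁻¹ * volume (closedBall 0 1 ∩ G)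
        + ENNReal.ofReal ((1 + δ) ^ 2 - 1) := by
      rw [mul_add, mul_left_comm, ENNReal.inv_mul_cancel hvol hvol', mul_one]
    _ ≤ _ := by
      gcongr
      exact h (by simpa [abs_of_nonneg hδ] using hlt)

/-- The radial truncation of the plane onto the closed disc of radius `2`. -/
noncomputable def clip (z : ℂ) : ℂ := (max 1 (‖z‖ / 2))⁻¹ • z

theorem continuous_clip : Continuous clip :=
  ((continuous_const.max (continuous_norm.div_const 2)).inv₀ fun _ ↦
    (lt_max_of_lt_left one_pos).ne').smul continuous_id

theorem norm_clip_le (z : ℂ) : ‖clip z‖ ≤ 2 := by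
  have h : 0 < max 1 (‖z‖ / 2) := lt_max_of_lt_left one_pos
  rw [clip, norm_smul, norm_inv, Real.norm_of_nonneg h.le, inv_mul_le_iff₀ h]
  linarith [le_max_right 1 (‖z‖ / 2)]

theorem clip_of_norm_le {z : ℂ} (hz : ‖z‖ ≤ 2) : clip z = z := by
  rw [clip, max_eq_left (by linarith), inv_one, one_smul]

theorem clip_mul {ζ : ℂ} (hζ : ‖ζ‖ = 1) (z : ℂ) : clip (ζ * z) = ζ * clip z := by
  rw [clip, clip, norm_mul, hζ, one_mul, mul_smul_comm]

section ClippedSeries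

variable {E : Type*} [NormedAddCommGroup E] [NormedSpace ℂ E] {v : ℕ → E}

/-- The series `∑ ωⱼ vⱼ` with coefficients truncated to the closed disc of radius `2`. -/
noncomputable def clippedSeries (v : ℕ → E) (ω : ℕ → ℂ) : E := ∑' j, clip (ω j) • v j

theorem norm_clip_smul_le (hv : ∀ j, ‖v j‖ ≤ (1 / 2) ^ j) (ω : ℕ → ℂ) (j : ℕ) :
    ‖clip (ω j) • v j‖ ≤ 2 * (1 / 2) ^ j := by
  rw [norm_smul]
  exact mul_le_mul (norm_clip_le _) (hv j) (norm_nonneg _) zero_le_two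

theorem continuous_clippedSeries [CompleteSpace E] (hv : ∀ j, ‖v j‖ ≤ (1 / 2) ^ j) :
    Continuous (clippedSeries v) :=
  continuous_tsum (fun j ↦ (continuous_clip.comp (continuous_apply j)).smul continuous_const)
    (summable_geometric_two.mul_left 2) fun j ω ↦ norm_clip_smul_le hv ω j

theorem norm_clippedSeries_le (hv : ∀ j, ‖v j‖ ≤ (1 / 2) ^ j) (ω : ℕ → ℂ) :
    ‖clippedSeries v ω‖ ≤ 4 :=
  tsum_of_norm_bounded ((by norm_num : (2 : ℝ) * 2 = 4) ▸ hasSum_geometric_two.mul_left 2)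
    (norm_clip_smul_le hv ω)

theorem clippedSeries_mul {ζ : ℂ} (hζ : ‖ζ‖ = 1) (ω : ℕ → ℂ) :
    clippedSeries v (fun j ↦ ζ * ω j) = ζ • clippedSeries v ω := by
  simp only [clippedSeries, clip_mul hζ, mul_smul, tsum_const_smul'']

theorem clippedSeries_update_add [CompleteSpace E] (hv : ∀ j, ‖v j‖ ≤ (1 / 2) ^ j) {ω : ℕ → ℂ}
    {m : ℕ} (hω : ‖ω m‖ ≤ 1) {δ : ℝ} (hδ : 0 ≤ δ) (hδ' : δ ≤ 1) :
    clippedSeries v (Function.update ω m (ω m + δ)) = clippedSeries v ω + (δ : ℂ) • v m := by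
  have hsum (ω : ℕ → ℂ) : Summable fun j ↦ clip (ω j) • v j :=
    .of_norm_bounded (summable_geometric_two.mul_left 2) (norm_clip_smul_le hv ω)
  rw [← sub_eq_iff_eq_add', clippedSeries, clippedSeries, ← (hsum _).tsum_sub (hsum _),
    tsum_eq_single m fun j hj ↦ by simp [Function.update_of_ne hj]]
  have h2 : ‖ω m + δ‖ ≤ 2 := by
    refine (norm_add_le _ _).trans ?_
    rw [Complex.norm_real, Real.norm_of_nonneg hδ]
    linarith
  rw [Function.update_self, clip_of_norm_le h2, clip_of_norm_le (hω.trans one_le_two), ← sub_smul,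
    add_sub_cancel_left]

end ClippedSeries

/-- The law of a sequence of independent uniform points of the closed unit disc. -/
noncomputable abbrev discSequenceMeasure : Measure (ℕ → ℂ) := Measure.infinitePi fun _ ↦ discMeasure

theorem measurePreserving_mul_discSequenceMeasure {ζ : ℂ} (hζ : ‖ζ‖ = 1) :
    MeasurePreserving (fun (ω : ℕ → ℂ) j ↦ ζ * ω j) discSequenceMeasure discSequenceMeasure := by
  refine ⟨by fun_prop, ?_⟩
  have h := Measure.infinitePi_map_pi (fun _ : ℕ ↦ discMeasure) (f := fun _ ↦ (ζ * ·))
    fun _ ↦ by fun_prop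
  simp only [map_mul_discMeasure hζ] at h
  exact h

theorem ae_norm_le_one_discSequenceMeasure (m : ℕ) : ∀ᵐ ω ∂discSequenceMeasure, ‖ω m‖ ≤ 1 := by
  have h : ∀ᵐ z ∂discMeasure, ‖z‖ ≤ 1 := by
    rw [ae_iff, discMeasure_apply]
    have : closedBall (0 : ℂ) 1 ∩ {z | ¬‖z‖ ≤ 1} = ∅ := by ext; simp
    rw [this, measure_empty, mul_zero]
  exact (measurePreserving_eval_infinitePi (fun _ : ℕ ↦ discMeasure) m).quasiMeasurePreserving.ae h

theorem posLog_norm_pow_div_le_circleAverage {A : Type*} [NormedRing A] [NormedAlgebra ℂ A]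
    {c : ℝ} (hc : 0 < c) (n : ℕ) (a z : A) :
    log⁺ (‖a ^ n‖ / c ^ n) ≤ circleAverage (fun ζ ↦ log⁺ (‖(a + ζ • z) ^ n‖ / c ^ n)) 0 1 := by
  have hf : Differentiable ℂ fun ζ : ℂ ↦ ((c : ℂ) ^ n)⁻¹ • (a + ζ • z) ^ n := by fun_prop
  have hnorm (w : A) : ‖((c : ℂ) ^ n)⁻¹ • w‖ = ‖w‖ / c ^ n := by
    rw [norm_smul, norm_inv, norm_pow, Complex.norm_real, Real.norm_of_nonneg hc.le, inv_mul_eq_div]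
  simpa only [hnorm, zero_smul, add_zero] using posLog_norm_le_circleAverage hf

theorem spectralRadius_le_of_measure_le {A : Type*} [NormedRing A] [NormedAlgebra ℂ A]
    [CompleteSpace A] {v : ℕ → A} (hv : ∀ j, ‖v j‖ ≤ (1 / 2) ^ j) (a : A) {c : ℝ} (hc : 0 < c)
    (h : ∀ η : ℝ, 0 < η → ∃ σ : ℂ, ‖σ‖ ≤ 1 ∧ discSequenceMeasure
      {ω | spectralRadius ℂ (a + σ • clippedSeries v ω) < ENNReal.ofReal c}ᶜ ≤ ENNReal.ofReal η) :
    spectralRadius ℂ a ≤ ENNReal.ofReal c := by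
  by_contra! hlt
  obtain ⟨c₁, hc₁0, hc₁, hc₁a⟩ := ENNReal.lt_iff_exists_real_btwn.1 hlt
  rw [ENNReal.ofReal_lt_ofReal_iff_of_nonneg hc.le] at hc₁
  set C := ‖a‖ + 4
  set L := log⁺ (C / c)
  have hL : 0 ≤ L := posLog_nonneg
  have hlog : 0 < log (c₁ / c) := log_pos ((one_lt_div hc).2 hc₁)
  set η := log (c₁ / c) / (2 * (L + 1))
  have hη : 0 < η := by positivity
  obtain ⟨σ, hσ, hmeas⟩ := h η hη
  set t : (ℕ → ℂ) → A := fun ω ↦ σ • clippedSeries v ω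
  have htc : Continuous t := (continuous_clippedSeries hv).const_smul σ
  have htb (ω) : ‖t ω‖ ≤ 4 := by
    rw [norm_smul]
    exact (mul_le_of_le_one_left (norm_nonneg _) hσ).trans (norm_clippedSeries_le hv ω)
  set U : ℕ → Set (ℕ → ℂ) := fun k ↦ {ω | ‖(a + t ω) ^ 2 ^ k‖ < c ^ 2 ^ k}
  have hUopen (k) : IsOpen (U k) := isOpen_lt (by fun_prop) (by fun_prop)
  have hUanti : Antitone fun k ↦ (U k)ᶜ := fun i j hij ↦
    Set.compl_subset_compl.2 fun ω hω ↦ norm_pow_two_pow_lt_mono hij hω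
  have hUinter : ⋂ k, (U k)ᶜ = {ω | spectralRadius ℂ (a + t ω) < ENNReal.ofReal c}ᶜ := by
    rw [← Set.compl_iUnion]
    congr 1
    ext ω
    rw [Set.mem_iUnion]
    exact ⟨fun ⟨k, hk⟩ ↦ spectralRadius_lt_of_norm_pow_lt hc (by positivity) hk,
      exists_norm_pow_two_pow_lt hc⟩
  have htend := tendsto_measure_iInter_atTop (μ := discSequenceMeasure)
    (fun k ↦ (hUopen k).measurableSet.compl.nullMeasurableSet) hUanti ⟨0, measure_ne_top _ _⟩
  rw [hUinter] at htend
  obtain ⟨k, hk⟩ := (htend.eventually_lt_const (hmeas.trans_lt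
    ((ENNReal.ofReal_lt_ofReal_iff (by positivity)).2 (lt_two_mul_self hη)))).exists
  set n := 2 ^ k
  have hn : 0 < n := by positivity
  set H : A → ℝ := fun x ↦ log⁺ (‖x ^ n‖ / c ^ n)
  have hHc : Continuous H := continuous_posLog.comp (by fun_prop)
  have hHb {x : A} (hx : ‖x‖ ≤ C) : H x ≤ n * L := by
    rw [← posLog_pow, div_pow]
    refine posLog_le_posLog (by positivity) ?_
    gcongr
    exact (norm_pow_le' x hn).trans (by gcongr)
  have hnorm {ζ : ℂ} (hζ : ‖ζ‖ = 1) (ω) : ‖a + ζ • t ω‖ ≤ C := by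
    refine (norm_add_le _ _).trans ?_
    rw [norm_smul, hζ, one_mul]
    exact add_le_add_right (htb ω) _
  have hnorm' (ω) : ‖a + t ω‖ ≤ C := by simpa using hnorm (norm_one (α := ℂ)) ω
  have hmean : H a ≤ ∫ ω, H (a + t ω) ∂discSequenceMeasure := by
    refine le_integral_of_le_circleAverage hHc htc a (C := n * L) (fun ζ hζ ω ↦ ?_)
      (posLog_norm_pow_div_le_circleAverage hc n a) fun ζ hζ ↦ ?_
    · rw [abs_of_nonneg posLog_nonneg]
      exact hHb (hnorm hζ ω)
    · have hmp := measurePreserving_mul_discSequenceMeasure hζ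
      have hrot (ω : ℕ → ℂ) : ζ • t ω = t fun j ↦ ζ * ω j := by
        simp only [t, clippedSeries_mul hζ, smul_comm σ ζ]
      simp only [hrot]
      rw [← integral_map (φ := fun (ω : ℕ → ℂ) j ↦ ζ * ω j) (f := fun ω ↦ H (a + t ω))
        hmp.measurable.aemeasurable (by
          rw [hmp.map_eq]
          exact (hHc.comp (continuous_const.add htc)).aestronglyMeasurable), hmp.map_eq]
  have hint : ∫ ω, H (a + t ω) ∂discSequenceMeasure ≤ 2 * η * (n * L) := by
    calc
      _ ≤ ∫ ω, (U k)ᶜ.indicator (fun _ ↦ n * L) ω ∂discSequenceMeasure := by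
        refine integral_mono ?_ ((integrable_const _).indicator (hUopen k).measurableSet.compl)
          fun ω ↦ ?_
        · refine Integrable.of_bound
            (hHc.comp (continuous_const.add htc)).aestronglyMeasurable (n * L)
            (ae_of_all _ fun ω ↦ ?_)
          rw [Real.norm_of_nonneg posLog_nonneg]
          exact hHb (hnorm' ω)
        · by_cases hω : ω ∈ U k
          · have : H (a + t ω) = 0 := by
              rw [posLog_eq_zero_iff, abs_of_nonneg (by positivity), div_le_one (by positivity)]
              exact le_of_lt hω
            simp [hω, this]
          · simpa [hω] using hHb (hnorm' ω)
      _ = discSequenceMeasure.real (U k)ᶜ * (n * L) := by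
        rw [integral_indicator_const _ (hUopen k).measurableSet.compl, smul_eq_mul]
      _ ≤ _ := by
        gcongr
        exact ENNReal.toReal_le_of_le_ofReal (by positivity) hk.le
  have hlow : n * log (c₁ / c) ≤ H a := by
    have hge : c₁ ^ n ≤ ‖a ^ n‖ := by
      by_contra! hcon
      exact hc₁a.not_gt (spectralRadius_lt_of_norm_pow_lt (hc.trans hc₁) hn.ne' hcon)
    rw [← log_pow, div_pow]
    refine le_trans (log_le_log ?_ ?_) (le_max_right _ _)
    · have := hc.trans hc₁
      positivity
    · gcongr
  have hfin : n * log (c₁ / c) ≤ n * (2 * η * L) := by linarith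
  have hfin' := le_of_mul_le_mul_left hfin (by positivity)
  have hη' : log (c₁ / c) = 2 * η * (L + 1) := by
    simp only [η]
    field_simp
  linarith

theorem spectralRadius_le_of_tendsto {A B : Type*}
    [NormedRing A] [NormedAlgebra ℂ A] [CompleteSpace A]
    [NormedRing B] [NormedAlgebra ℂ B] [CompleteSpace B]
    (T : A →+ B) (hr : ∀ x, spectralRadius ℂ (T x) = spectralRadius ℂ x)
    {x : ℕ → A} (hx : Tendsto x atTop (𝓝 0)) {b : B}
    (hb : Tendsto (fun n ↦ T (x n)) atTop (𝓝 b)) (a : A) :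
    spectralRadius ℂ a ≤ spectralRadius ℂ (b + T a) := by
  refine le_of_forall_gt_imp_ge_of_dense fun d hd ↦ ?_
  obtain ⟨c, -, hc, hcd⟩ := ENNReal.lt_iff_exists_real_btwn.1 hd
  refine le_trans ?_ hcd.le
  have hc0 : 0 < c := ENNReal.ofReal_pos.1 (pos_of_gt hc)
  obtain ⟨ε, hε, hball⟩ := Metric.isOpen_iff.1 (isOpen_setOf_spectralRadius_lt hc0) (b + T a) hc
  have hsmall (j : ℕ) : ∃ N, ∀ n ≥ N, ‖x n‖ ≤ (1 / 2) ^ j / (j + 1) :=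
    eventually_atTop.1 (hx.norm.eventually_le_const (by simpa using by positivity))
  choose N hN using hsmall
  set u : ℕ → A := fun j ↦ x (max (N j) j)
  have hub : Tendsto (fun j ↦ T (u j)) atTop (𝓝 b) :=
    hb.comp (tendsto_atTop_mono (fun j ↦ le_max_right _ _) tendsto_id)
  set v : ℕ → A := fun j ↦ ((j : ℂ) + 1) • u j
  have hnj (j : ℕ) : ‖(j : ℂ) + 1‖ = j + 1 := by
    exact_mod_cast Complex.norm_natCast (j + 1)
  have hv (j) : ‖v j‖ ≤ (1 / 2) ^ j := by
    rw [norm_smul, hnj, mul_comm, ← le_div_iff₀ (by positivity)]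
    exact hN j _ (le_max_left _ _)
  refine spectralRadius_le_of_measure_le hv a hc0 fun η hη ↦ ?_
  set F : ℕ → Set (ℕ → ℂ) := fun K ↦ {ω | ‖T (clippedSeries v ω)‖ ≤ K}
  have hFmono : Monotone F := fun i j hij ω hω ↦ le_trans (α := ℝ) hω (Nat.cast_le.2 hij)
  have hFunion : ⋃ K, F K = Set.univ :=
    Set.eq_univ_of_forall fun ω ↦ Set.mem_iUnion.2 (exists_nat_ge ‖T (clippedSeries v ω)‖)
  have hFtend := tendsto_measure_iUnion_atTop (μ := discSequenceMeasure) hFmono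
  rw [hFunion, measure_univ] at hFtend
  set η' := ENNReal.ofReal (η / 2)
  have hη' : 0 < η' := ENNReal.ofReal_pos.2 (by positivity)
  obtain ⟨K, hK⟩ := ((hFtend.add_const η').eventually_const_lt
    (ENNReal.lt_add_right ENNReal.one_ne_top hη'.ne')).exists
  obtain ⟨M, hM⟩ := exists_nat_gt (max 1 (2 * K / ε))
  have hM1 : (1 : ℝ) < M := (le_max_left _ _).trans_lt hM
  have hM0 : (0 : ℝ) < M := one_pos.trans hM1
  have hKM : K / M < ε / 2 := by
    have := (le_max_right _ _).trans_lt hM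
    rw [div_lt_iff₀ hε] at this
    rw [div_lt_iff₀ hM0]
    linarith
  obtain ⟨δ₀, hδ₀, hδ₀'⟩ := exists_discMeasure_preimage_add_le hη'
  have hδtend : Tendsto (fun m : ℕ ↦ (M : ℝ) / (m + 1)) atTop (𝓝 0) :=
    by simpa [div_eq_mul_inv] using tendsto_one_div_add_atTop_nhds_zero_nat.const_mul (M : ℝ)
  obtain ⟨m, hmδ, hmb⟩ := ((hδtend.eventually_lt_const (lt_min hδ₀ one_pos)).and
    (Metric.tendsto_nhds.1 hub (ε / 2) (by positivity))).exists
  set δ : ℝ := M / (m + 1)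
  have hδ : 0 ≤ δ := by positivity
  have hMC : (M : ℂ) ≠ 0 := by exact_mod_cast hM0.ne'
  refine ⟨(M : ℂ)⁻¹, ?_, ?_⟩
  · rw [norm_inv, Complex.norm_natCast]
    exact inv_le_one_of_one_le₀ hM1.le
  set U := {ω | spectralRadius ℂ (a + (M : ℂ)⁻¹ • clippedSeries v ω) < ENNReal.ofReal c}
  have hU : MeasurableSet U := by
    refine IsOpen.measurableSet ((isOpen_setOf_spectralRadius_lt (A := A) hc0).preimage ?_)
    exact continuous_const.add ((continuous_clippedSeries hv).const_smul _)
  have hsub : discSequenceMeasure (F K) ≤ discSequenceMeasure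
      ((fun ω ↦ Function.update ω m (ω m + (δ : ℂ))) ⁻¹' U) := by
    refine measure_mono_ae ?_
    filter_upwards [ae_norm_le_one_discSequenceMeasure m] with ω hω hωK
    have hshift : (M : ℂ)⁻¹ • clippedSeries v (Function.update ω m (ω m + δ))
        = (M : ℂ)⁻¹ • clippedSeries v ω + u m := by
      rw [clippedSeries_update_add hv hω hδ (hmδ.le.trans (min_le_right _ _)), smul_add, smul_smul,
        smul_smul]
      have hm0 : (m : ℂ) + 1 ≠ 0 := by exact_mod_cast m.succ_ne_zero
      have : (M : ℂ)⁻¹ * (δ : ℂ) * ((m : ℂ) + 1) = 1 := by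
        simp only [δ]
        push_cast
        field_simp
      rw [this, one_smul]
    have hTw : ‖T ((M : ℂ)⁻¹ • clippedSeries v ω)‖ < ε / 2 := by
      have h1 : T (clippedSeries v ω) = (M : ℂ) • T ((M : ℂ)⁻¹ • clippedSeries v ω) := by
        rw [Nat.cast_smul_eq_nsmul, ← map_nsmul, ← Nat.cast_smul_eq_nsmul ℂ, smul_inv_smul₀ hMC]
      have h2 : ‖T (clippedSeries v ω)‖ ≤ K := hωK
      rw [h1, norm_smul, Complex.norm_natCast, mul_comm, ← le_div_iff₀ hM0] at h2
      exact h2.trans_lt hKM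
    change spectralRadius ℂ _ < _
    rw [hshift, ← hr]
    refine hball ?_
    rw [mem_ball, dist_eq_norm]
    rw [dist_eq_norm] at hmb
    have : T (a + ((M : ℂ)⁻¹ • clippedSeries v ω + u m)) - (b + T a)
        = T ((M : ℂ)⁻¹ • clippedSeries v ω) + (T (u m) - b) := by
      rw [map_add, map_add]
      abel
    rw [this]
    exact (norm_add_le _ _).trans_lt (by linarith)
  have hshift := infinitePi_preimage_update_le (fun _ : ℕ ↦ discMeasure) m
    (f := (· + (δ : ℂ))) (by fun_prop)
    (fun G _ ↦ hδ₀' δ hδ (hmδ.trans_le (min_le_left _ _)) G) hU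
  rw [prob_compl_eq_one_sub hU, tsub_le_iff_left]
  calc
    1 ≤ discSequenceMeasure (F K) + η' := hK.le
    _ ≤ discSequenceMeasure U + η' + η' := by gcongr; exact hsub.trans hshift
    _ = discSequenceMeasure U + ENNReal.ofReal η := by
      rw [add_assoc, ← ENNReal.ofReal_add (by positivity) (by positivity), add_halves]

end

/-- For a surjective additive spectral-radius preserving map `T : A → B` between complex
unital Banach algebras, every element `b` of the separating space `𝒮(T)` satisfies
`r(y) ≤ r(b + y)` for all `y ∈ B`; in particular every such `b` is quasinilpotent. -/
theorem separating_space_spectralRadius_bound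
    {A B : Type*} [NormedRing A] [NormedAlgebra ℂ A] [CompleteSpace A]
    [NormedRing B] [NormedAlgebra ℂ B] [CompleteSpace B]
    (T : A → B)
    (hsurj : Function.Surjective T)
    (hadd : ∀ x y : A, T (x + y) = T x + T y)
    (hr : ∀ x : A, spectralRadius ℂ (T x) = spectralRadius ℂ x) :
    ∀ b : B,
      (∃ x : ℕ → A, Filter.Tendsto x Filter.atTop (nhds 0) ∧
          Filter.Tendsto (fun n => T (x n)) Filter.atTop (nhds b)) →
      (∀ y : B, spectralRadius ℂ y ≤ spectralRadius ℂ (b + y)) ∧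
        spectralRadius ℂ b = 0 := by
  let S : A →+ B := AddMonoidHom.mk' T hadd
  have key {b : B} {x : ℕ → A} (hx : Filter.Tendsto x Filter.atTop (nhds 0))
      (hb : Filter.Tendsto (fun n => T (x n)) Filter.atTop (nhds b)) (y : B) :
      spectralRadius ℂ y ≤ spectralRadius ℂ (b + y) := by
    obtain ⟨a, rfl⟩ := hsurj y
    rw [hr a]
    exact spectralRadius_le_of_tendsto S hr hx hb a
  rintro b ⟨x, hx, hb⟩
  refine ⟨key hx hb, ?_⟩
  have hx' : Filter.Tendsto (fun n => -x n) Filter.atTop (nhds 0) := by simpa using hx.neg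
  have hb' : Filter.Tendsto (fun n => T (-x n)) Filter.atTop (nhds (-b)) :=
    hb.neg.congr fun n => (map_neg S (x n)).symm
  simpa using key hx' hb' b
end
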